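/- arXiv:1603.04653 — 8 statements merged into one kernel-verified Lean document; each statement's English description precedes it below -/
import Mathlib

section
/- For all real numbers α, ε with 0 < α ≤ 1 and 0 < ε ≤ 1, the quantity κ(α,ε) := ((1+ε^{1/2})^α − ε^{α/2})/α satisfies ln(2) ≤ κ(α,ε) ≤ min{ α^{−1}, 1 + |log₂(ε^{1/2})| }. -/
/-- The increment of a concave power over a unit interval starting in `[0, 1]` is smallest at `1`. -/
theorem two_rpow_sub_one_le {α t : ℝ} (hα0 : 0 ≤ α) (hα1 : α ≤ 1) (ht0 : 0 ≤ t) (ht1 : t ≤ 1) :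
    (2:ℝ) ^ α - 1 ≤ (1 + t) ^ α - t ^ α := by
  have hc := Real.concaveOn_rpow hα0 hα1
  have ht : (0:ℝ) < 2 - t := by linarith
  have hl : 0 ≤ 1 / (2 - t) := by positivity
  have hm : 0 ≤ (1 - t) / (2 - t) := div_nonneg (by linarith) ht.le
  have hs : 1 / (2 - t) + (1 - t) / (2 - t) = 1 := by field_simp; ring
  have h1 := hc.2 (Set.mem_Ici.2 ht0) (Set.mem_Ici.2 zero_le_two) hl hm hs
  have h2 := hc.2 (Set.mem_Ici.2 zero_le_two) (Set.mem_Ici.2 ht0) hl hm hs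
  simp only [smul_eq_mul] at h1 h2
  have e1 : 1 / (2 - t) * t + (1 - t) / (2 - t) * 2 = 1 := by field_simp; ring
  have e2 : 1 / (2 - t) * 2 + (1 - t) / (2 - t) * t = 1 + t := by field_simp; ring
  rw [e1, Real.one_rpow] at h1
  rw [e2] at h2
  linear_combination h1 + h2 - (t ^ α + 2 ^ α) * hs

/-- Powers lie above the tangent in the exponent at `0`. -/
theorem one_add_mul_log_le_rpow {x : ℝ} (hx : 0 < x) (α : ℝ) :
    1 + α * Real.log x ≤ x ^ α := by
  rw [Real.rpow_def_of_pos hx]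
  linarith [Real.add_one_le_exp (Real.log x * α)]

theorem kappa_bounds (α ε : ℝ) (hα0 : 0 < α) (hα1 : α ≤ 1) (hε0 : 0 < ε) (hε1 : ε ≤ 1) :
    Real.log 2 ≤ ((1 + ε ^ ((1:ℝ)/2)) ^ α - ε ^ (α/2)) / α ∧
    ((1 + ε ^ ((1:ℝ)/2)) ^ α - ε ^ (α/2)) / α ≤
      min α⁻¹ (1 + |Real.logb 2 (ε ^ ((1:ℝ)/2))|) := by
  have hpow : ε ^ (α/2) = (ε ^ ((1:ℝ)/2)) ^ α := by
    rw [← Real.rpow_mul hε0.le]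
    congr 1
    ring
  rw [hpow]
  have ht0 : 0 < ε ^ ((1:ℝ)/2) := Real.rpow_pos_of_pos hε0 _
  have ht1 : ε ^ ((1:ℝ)/2) ≤ 1 := Real.rpow_le_one hε0.le hε1 (by norm_num)
  generalize ε ^ ((1:ℝ)/2) = t at ht0 ht1 ⊢
  refine ⟨?_, le_min ?_ ?_⟩
  · rw [le_div_iff₀ hα0]
    linarith [two_rpow_sub_one_le hα0.le hα1 ht0.le ht1,
      one_add_mul_log_le_rpow (zero_lt_two (α := ℝ)) α]
  · rw [inv_eq_one_div]
    gcongr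
    have h := Real.rpow_add_le_add_rpow zero_le_one ht0.le hα0.le hα1
    rw [Real.one_rpow] at h
    linarith
  · have hlog : Real.log t ≤ 0 := Real.log_nonpos ht0.le ht1
    have hlogb : -Real.log t ≤ |Real.logb 2 t| := by
      rw [Real.logb, abs_div, abs_of_nonpos hlog, abs_of_pos (Real.log_pos one_lt_two)]
      exact le_div_self (by linarith) (Real.log_pos one_lt_two)
        (by linarith [Real.log_two_lt_d9])
    have hbern := rpow_one_add_le_one_add_mul_self (by linarith : -1 ≤ t) hα0.le hα1
    calc ((1 + t) ^ α - t ^ α) / α ≤ t - Real.log t := by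
          rw [div_le_iff₀ hα0]
          linarith [one_add_mul_log_le_rpow ht0 α]
      _ ≤ 1 + |Real.logb 2 t| := by linarith
end

section
/- Let k ≥ 1 be an integer, let α̂ > 0 and 0 < α ≤ min{α̂/k, 1}. Then there is a constant C, depending only on α, α̂ and k (not on ε or N), such that for every 0 < ε ≤ 1, every integer N ≥ 1 and every i with 2 ≤ i ≤ N: h_i^k (x_{i−1} + ε^{1/2})^{α̂−k} ≤ C h^k. -/
/-- Liseikin's mesh generating function on `[-1,1]`
(extended to all of `ℝ` by the same formulas). -/
noncomputable def liseikinPhi (α ε ξ : ℝ) : ℝ :=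
  if 0 ≤ ξ then
    (ε ^ (α/2) + ξ * ((1 + ε ^ ((1:ℝ)/2)) ^ α - ε ^ (α/2))) ^ (1/α) - ε ^ ((1:ℝ)/2)
  else
    ε ^ ((1:ℝ)/2) - (ε ^ (α/2) + (-ξ) * ((1 + ε ^ ((1:ℝ)/2)) ^ α - ε ^ (α/2))) ^ (1/α)

/-- The mesh points `x_i = φ(i/N, ε)`, `i = -N, …, N`. -/
noncomputable def liseikinX (α ε : ℝ) (N : ℕ) (i : ℤ) : ℝ :=
  liseikinPhi α ε ((i : ℝ) / N)

/-- The mesh widths `h_i = x_i - x_{i-1}`. -/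
noncomputable def liseikinH (α ε : ℝ) (N : ℕ) (i : ℤ) : ℝ :=
  liseikinX α ε N i - liseikinX α ε N (i - 1)

/-- Tangent-line bound for the convex power `t ↦ t ^ p`. -/
theorem rpow_sub_rpow_le_mul {p u v : ℝ} (hp : 1 ≤ p) (hu : 0 ≤ u) (hv : 0 < v) :
    v ^ p - u ^ p ≤ p * v ^ (p - 1) * (v - u) := by
  have h := one_add_mul_self_le_rpow_one_add (s := u / v - 1)
    (by linarith [div_nonneg hu hv.le]) hp
  rw [add_sub_cancel, Real.div_rpow hu hv.le, le_div_iff₀ (Real.rpow_pos_of_pos hv p)] at h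
  have hvp : v ^ p = v ^ (p - 1) * v := by
    rw [← Real.rpow_add_one hv.ne', sub_add_cancel]
  have heq : (1 + p * (u / v - 1)) * v ^ p = v ^ p - p * v ^ (p - 1) * (v - u) := by
    rw [hvp]
    field_simp
    ring
  linarith

/-- On the right half of the mesh, `x_i + ε^{1/2}` is a power of an affine function of `i / N`. -/
theorem liseikinX_of_nonneg (α ε : ℝ) (N : ℕ) {i : ℤ} (hi : 0 ≤ i) :
    liseikinX α ε N i =
      (ε ^ (α / 2) + (i : ℝ) / N * ((1 + ε ^ ((1 : ℝ) / 2)) ^ α - ε ^ (α / 2))) ^ (1 / α)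
        - ε ^ ((1 : ℝ) / 2) := by
  have h : (0 : ℝ) ≤ (i : ℝ) / N := div_nonneg (by exact_mod_cast hi) (Nat.cast_nonneg N)
  rw [liseikinX, liseikinPhi, if_pos h]

/-- Consecutive values `u ≤ v ≤ 2 u` with `v - u ≤ 2 δ` satisfy the mesh-width estimate. -/
theorem rpow_sub_rpow_pow_mul_le {k : ℕ} {β p u v δ : ℝ} (hp : 1 ≤ p) (hβ : (k : ℝ) ≤ p * β)
    (hu : 0 < u) (huv : u ≤ v) (hv : v ≤ 2 * u) (hu2 : u ≤ 2) (hδ : v - u ≤ 2 * δ) :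
    (v ^ p - u ^ p) ^ k * (u ^ p) ^ (β - k)
      ≤ (p * 2 ^ (p - 1) * 2) ^ k * 2 ^ (p * β - k) * δ ^ k := by
  have hδ0 : 0 ≤ δ := by linarith
  have hp1 : 0 ≤ p - 1 := by linarith
  have hwidth : v ^ p - u ^ p ≤ p * 2 ^ (p - 1) * 2 * δ * u ^ (p - 1) := by
    calc v ^ p - u ^ p ≤ p * v ^ (p - 1) * (v - u) :=
          rpow_sub_rpow_le_mul hp hu.le (hu.trans_le huv)
      _ ≤ p * (2 * u) ^ (p - 1) * (2 * δ) := by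
          have := hu.trans_le huv
          gcongr
      _ = _ := by
          rw [Real.mul_rpow (by norm_num) hu.le]
          ring
  have hexp : (u ^ (p - 1)) ^ k * (u ^ p) ^ (β - k) = u ^ (p * β - k) := by
    rw [← Real.rpow_natCast, ← Real.rpow_mul hu.le, ← Real.rpow_mul hu.le, ← Real.rpow_add hu]
    congr 1
    ring
  calc (v ^ p - u ^ p) ^ k * (u ^ p) ^ (β - k)
      ≤ (p * 2 ^ (p - 1) * 2 * δ * u ^ (p - 1)) ^ k * (u ^ p) ^ (β - k) := by
        have : 0 ≤ v ^ p - u ^ p :=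
          sub_nonneg.2 (Real.rpow_le_rpow hu.le huv (by linarith))
        gcongr
    _ = (p * 2 ^ (p - 1) * 2) ^ k * u ^ (p * β - k) * δ ^ k := by
        rw [mul_pow _ (u ^ (p - 1)), mul_pow _ δ, mul_assoc, hexp]
        ring
    _ ≤ _ := by
        gcongr

theorem liseikin_hk_bound (k : ℕ) (hk : 1 ≤ k) (αhat α : ℝ)
    (hαhat : 0 < αhat) (hα0 : 0 < α) (hα : α ≤ min (αhat / k) 1) :
    ∃ C : ℝ, 0 < C ∧
      ∀ ε : ℝ, 0 < ε → ε ≤ 1 → ∀ N : ℕ, 1 ≤ N → ∀ i : ℤ, 2 ≤ i → i ≤ N →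
        liseikinH α ε N i ^ k * (liseikinX α ε N (i-1) + ε ^ ((1:ℝ)/2)) ^ (αhat - k)
          ≤ C * ((1:ℝ)/N) ^ k := by
  obtain ⟨hαk, hα1⟩ := le_min_iff.1 hα
  have hk0 : (0 : ℝ) < k := by exact_mod_cast hk
  refine ⟨(1 / α * 2 ^ (1 / α - 1) * 2) ^ k * 2 ^ (1 / α * αhat - k), by positivity, ?_⟩
  intro ε hε hε1 N hN i hi hiN
  have hN0 : (0 : ℝ) < N := by exact_mod_cast hN
  have hi' : (2 : ℝ) ≤ i := by exact_mod_cast hi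
  have hiN' : (i : ℝ) ≤ N := by exact_mod_cast hiN
  rw [liseikinH, liseikinX_of_nonneg α ε N (by lia : 0 ≤ i),
    liseikinX_of_nonneg α ε N (by lia : 0 ≤ i - 1), sub_sub_sub_cancel_right, sub_add_cancel]
  have hs : 0 < ε ^ ((1 : ℝ) / 2) := Real.rpow_pos_of_pos hε _
  have hs1 : ε ^ ((1 : ℝ) / 2) ≤ 1 := Real.rpow_le_one hε.le hε1 (by norm_num)
  have ha : 0 < ε ^ (α / 2) := Real.rpow_pos_of_pos hε _
  have ha1 : ε ^ (α / 2) ≤ 1 := Real.rpow_le_one hε.le hε1 (by positivity)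
  have hb1 : 1 ≤ (1 + ε ^ ((1 : ℝ) / 2)) ^ α := Real.one_le_rpow (by linarith) hα0.le
  have hb2 : (1 + ε ^ ((1 : ℝ) / 2)) ^ α ≤ 2 :=
    (Real.rpow_le_self_of_one_le (by linarith) hα1).trans (by linarith)
  generalize (1 + ε ^ ((1 : ℝ) / 2)) ^ α = b at *
  generalize ε ^ (α / 2) = a at *
  have hx : (((i - 1 : ℤ) : ℝ)) / N = (i : ℝ) / N - 1 / N := by
    push_cast
    ring
  have hδ : (0 : ℝ) < 1 / N := by positivity
  have h2 : 2 * (1 / (N : ℝ)) ≤ (i : ℝ) / N := by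
    rw [mul_one_div]
    gcongr
  have h3 : (i : ℝ) / N ≤ 1 := (div_le_one hN0).2 hiN'
  rw [hx]
  generalize (i : ℝ) / N = x at *
  generalize 1 / (N : ℝ) = δ at *
  have hd : 0 ≤ b - a := by linarith
  refine rpow_sub_rpow_pow_mul_le ((one_le_div hα0).2 hα1) ?_ ?_ ?_ ?_ ?_ ?_
  · rw [one_div_mul_eq_div, le_div_iff₀ hα0, mul_comm]
    exact (le_div_iff₀ hk0).1 hαk
  · nlinarith [mul_nonneg (by linarith : 0 ≤ x - δ) hd]
  · nlinarith [mul_nonneg hδ.le hd]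
  · nlinarith [mul_nonneg (by linarith : 0 ≤ x - 2 * δ) hd]
  · nlinarith [mul_nonneg (by linarith : 0 ≤ 1 - (x - δ)) hd]
  · nlinarith [mul_nonneg hδ.le (by linarith : 0 ≤ 2 - (b - a))]
end

section
/- Let k ≥ 1 be an integer, let α̂ > 0 and 0 < α ≤ min{α̂/k, 1}. Then there is a constant C, depending only on α, α̂ and k, such that for every integer N ≥ 1 and every 0 < ε ≤ 1 with ε ≥ h^{2/α}: h_1^k ε^{(α̂−k)/2} ≤ C h^k; in particular h_1^k (x_0 + ε^{1/2})^{α̂−k} ≤ C h^k, since x_0 = 0. -/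
/-- Tangent-line bound for the convex power function. -/
theorem rpow_sub_rpow_le_mul_s3 {a b p : ℝ} (ha : 0 ≤ a) (hb : 0 < b) (hp : 1 ≤ p) :
    b ^ p - a ^ p ≤ p * (b - a) * b ^ (p - 1) := by
  have key := one_add_mul_self_le_rpow_one_add (s := a / b - 1)
    (by linarith [div_nonneg ha hb.le]) hp
  rw [add_sub_cancel, Real.div_rpow ha hb.le, le_div_iff₀ (Real.rpow_pos_of_pos hb p)] at key
  have hbp : b ^ p = b ^ (p - 1) * b := by
    rw [← Real.rpow_add_one hb.ne', sub_add_cancel]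
  have hab : (1 + p * (a / b - 1)) * b ^ p = b ^ p - p * (b - a) * b ^ (p - 1) := by
    rw [hbp]
    field_simp
    ring
  linarith

theorem liseikinX_zero {α ε : ℝ} (hα : α ≠ 0) (hε : 0 ≤ ε) (N : ℕ) :
    liseikinX α ε N 0 = 0 := by
  simp only [liseikinX, liseikinPhi, Int.cast_zero, zero_div, le_refl, if_true, zero_mul, add_zero]
  rw [← Real.rpow_mul hε, show α / 2 * (1 / α) = 1 / 2 by field_simp, sub_self]

/-- The first mesh width is nonnegative and of size `h ε ^ ((1 - α) / 2)`. -/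
theorem liseikinH_one_bounds {α ε : ℝ} {N : ℕ} (hα0 : 0 < α) (hα1 : α ≤ 1) (hN : 1 ≤ N)
    (hε0 : 0 < ε) (hε1 : ε ≤ 1) (hε : ((1 : ℝ) / N) ^ (2 / α) ≤ ε) :
    0 ≤ liseikinH α ε N 1 ∧
      liseikinH α ε N 1 ≤
        1 / α * 2 * 3 ^ (1 / α - 1) * ((1 : ℝ) / N) * ε ^ ((1 - α) / 2) := by
  have hN0 : (0 : ℝ) < N := by exact_mod_cast hN
  have hh : (0 : ℝ) < 1 / N := by positivity
  have hH : liseikinH α ε N 1 = (ε ^ (α / 2) + (1 : ℝ) / N *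
      ((1 + ε ^ ((1 : ℝ) / 2)) ^ α - ε ^ (α / 2))) ^ (1 / α) - (ε ^ (α / 2)) ^ (1 / α) := by
    rw [liseikinH, sub_self, liseikinX_zero hα0.ne' hε0.le, sub_zero, liseikinX, liseikinPhi,
      Int.cast_one, if_pos hh.le, ← Real.rpow_mul hε0.le,
      show α / 2 * (1 / α) = 1 / 2 by field_simp]
  have hha : (1 : ℝ) / N ≤ ε ^ (α / 2) := by
    have := Real.rpow_le_rpow (by positivity) hε (by positivity : 0 ≤ α / 2)
    rwa [← Real.rpow_mul hh.le, show 2 / α * (α / 2) = 1 by field_simp, Real.rpow_one] at this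
  have hs0 : 0 < ε ^ ((1 : ℝ) / 2) := by positivity
  have hs1 : ε ^ ((1 : ℝ) / 2) ≤ 1 := Real.rpow_le_one hε0.le hε1 (by norm_num)
  have ha0 : 0 < ε ^ (α / 2) := by positivity
  have has : ε ^ (α / 2) = (ε ^ ((1 : ℝ) / 2)) ^ α := by
    rw [← Real.rpow_mul hε0.le]
    ring_nf
  have hd0 : 0 ≤ (1 + ε ^ ((1 : ℝ) / 2)) ^ α - ε ^ (α / 2) := by
    rw [has, sub_nonneg]
    exact Real.rpow_le_rpow hs0.le (by linarith) hα0.le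
  have hd2 : (1 + ε ^ ((1 : ℝ) / 2)) ^ α - ε ^ (α / 2) ≤ 2 := by
    have := Real.rpow_le_rpow_of_exponent_le
      (by linarith : 1 ≤ 1 + ε ^ ((1 : ℝ) / 2)) hα1
    rw [Real.rpow_one] at this
    linarith
  have hae : (ε ^ (α / 2)) ^ (1 / α - 1) = ε ^ ((1 - α) / 2) := by
    rw [← Real.rpow_mul hε0.le]
    congr 1
    field_simp
  have hp : 1 ≤ 1 / α := by rwa [one_le_div hα0]
  rw [hH, ← hae]
  generalize (1 + ε ^ ((1 : ℝ) / 2)) ^ α - ε ^ (α / 2) = d at *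
  generalize ε ^ (α / 2) = a at *
  generalize (1 : ℝ) / N = h at *
  have hhd : 0 ≤ h * d := by positivity
  have hb : 0 < a + h * d := by positivity
  constructor
  · rw [sub_nonneg]
    exact Real.rpow_le_rpow ha0.le (by linarith) (by linarith)
  · calc (a + h * d) ^ (1 / α) - a ^ (1 / α)
        ≤ 1 / α * (a + h * d - a) * (a + h * d) ^ (1 / α - 1) :=
          rpow_sub_rpow_le_mul_s3 ha0.le hb hp
      _ ≤ 1 / α * (h * 2) * (3 * a) ^ (1 / α - 1) := by
          rw [add_sub_cancel_left]
          have hp' : 0 ≤ 1 / α - 1 := by linarith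
          have hle : a + h * d ≤ 3 * a := by nlinarith
          gcongr
      _ = 1 / α * 2 * 3 ^ (1 / α - 1) * h * a ^ (1 / α - 1) := by
          rw [Real.mul_rpow (by norm_num) ha0.le]
          ring

theorem liseikin_h1_bound (k : ℕ) (hk : 1 ≤ k) (αhat α : ℝ)
    (hαhat : 0 < αhat) (hα0 : 0 < α) (hα : α ≤ min (αhat / k) 1) :
    ∃ C : ℝ, 0 < C ∧
      ∀ N : ℕ, 1 ≤ N → ∀ ε : ℝ, 0 < ε → ε ≤ 1 → ((1:ℝ)/N) ^ (2/α) ≤ ε →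
        liseikinH α ε N 1 ^ k * ε ^ ((αhat - k)/2) ≤ C * ((1:ℝ)/N) ^ k ∧
        liseikinH α ε N 1 ^ k * (liseikinX α ε N 0 + ε ^ ((1:ℝ)/2)) ^ (αhat - k)
          ≤ C * ((1:ℝ)/N) ^ k := by
  have hα1 : α ≤ 1 := hα.trans (min_le_right _ _)
  have hk0 : (0 : ℝ) < k := by exact_mod_cast hk
  have hαk : α * k ≤ αhat := (le_div_iff₀ hk0).1 (hα.trans (min_le_left _ _))
  refine ⟨(1 / α * 2 * 3 ^ (1 / α - 1)) ^ k, by positivity, fun N hN ε hε0 hε1 hε => ?_⟩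
  obtain ⟨hH0, hH⟩ := liseikinH_one_bounds hα0 hα1 hN hε0 hε1 hε
  rw [liseikinX_zero hα0.ne' hε0.le, zero_add, ← Real.rpow_mul hε0.le,
    one_div_mul_eq_div 2 (αhat - k : ℝ), and_self]
  calc liseikinH α ε N 1 ^ k * ε ^ ((αhat - k) / 2)
      ≤ (1 / α * 2 * 3 ^ (1 / α - 1) * ((1 : ℝ) / N) * ε ^ ((1 - α) / 2)) ^ k *
          ε ^ ((αhat - k) / 2) := by gcongr
    _ = (1 / α * 2 * 3 ^ (1 / α - 1)) ^ k * ((1 : ℝ) / N) ^ k *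
          ε ^ ((αhat - α * k) / 2) := by
        rw [mul_pow, mul_pow, ← Real.rpow_mul_natCast hε0.le, mul_assoc _ (ε ^ _),
          ← Real.rpow_add hε0]
        ring_nf
    _ ≤ (1 / α * 2 * 3 ^ (1 / α - 1)) ^ k * ((1 : ℝ) / N) ^ k :=
        mul_le_of_le_one_right (by positivity)
          (Real.rpow_le_one hε0.le hε1 (by linarith))
end

section
/- Let k ≥ 1 be an integer and 0 < α ≤ 1/k. Then for every integer N ≥ 1 and every 0 < ε ≤ 1 with ε ≤ h^{2/α}, the first mesh point to the right of the origin satisfies x_1 ≤ 2^{1/α} h^k. -/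
theorem liseikin_x1_bound (k : ℕ) (hk : 1 ≤ k) (α : ℝ)
    (hα0 : 0 < α) (hα : α ≤ 1 / k) :
    ∀ N : ℕ, 1 ≤ N → ∀ ε : ℝ, 0 < ε → ε ≤ 1 → ε ≤ ((1:ℝ)/N) ^ (2/α) →
      liseikinX α ε N 1 ≤ 2 ^ (1/α) * ((1:ℝ)/N) ^ k := by
  intro N hN ε hε _ hεN
  have hk' : (1:ℝ) ≤ k := by exact_mod_cast hk
  have hN' : (1:ℝ) ≤ N := by exact_mod_cast hN
  have hα1 : α ≤ 1 := hα.trans (by rw [div_le_one (by linarith)]; exact hk')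
  have hkα : (k:ℝ) ≤ 1 / α := by
    rw [le_div_iff₀ (by linarith)] at hα
    rw [le_div_iff₀ hα0]
    linarith
  have hX : liseikinX α ε N 1 = (ε ^ (α/2) + (1:ℝ)/N * ((1 + ε ^ ((1:ℝ)/2)) ^ α - ε ^ (α/2)))
      ^ (1/α) - ε ^ ((1:ℝ)/2) := by
    rw [liseikinX, liseikinPhi, if_pos (by positivity)]
    norm_num
  rw [hX]
  have h0 : 0 < (1:ℝ)/N := by positivity
  have h1 : (1:ℝ)/N ≤ 1 := by rw [div_le_one (by linarith)]; exact hN'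
  generalize (1:ℝ)/N = h at *
  have hδ : 0 < ε ^ ((1:ℝ)/2) := by positivity
  have hpow : (ε ^ ((1:ℝ)/2)) ^ α = ε ^ (α/2) := by
    rw [← Real.rpow_mul hε.le]
    ring_nf
  have hsmall : ε ^ (α/2) ≤ h := by
    calc ε ^ (α/2) ≤ (h ^ (2/α)) ^ (α/2) := Real.rpow_le_rpow hε.le hεN (by positivity)
      _ = h := by
        rw [← Real.rpow_mul h0.le, show 2/α * (α/2) = 1 by field_simp, Real.rpow_one]
  have hsub : (1 + ε ^ ((1:ℝ)/2)) ^ α ≤ 1 + ε ^ (α/2) := by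
    have := Real.rpow_add_le_add_rpow zero_le_one hδ.le hα0.le hα1
    rwa [Real.one_rpow, hpow] at this
  have hmono : ε ^ (α/2) ≤ (1 + ε ^ ((1:ℝ)/2)) ^ α := by
    rw [← hpow]
    exact Real.rpow_le_rpow hδ.le (by linarith) hα0.le
  have he : 0 < ε ^ (α/2) := by positivity
  have hbase : ε ^ (α/2) + h * ((1 + ε ^ ((1:ℝ)/2)) ^ α - ε ^ (α/2)) ≤ 2 * h := by
    nlinarith
  have hnonneg : 0 ≤ ε ^ (α/2) + h * ((1 + ε ^ ((1:ℝ)/2)) ^ α - ε ^ (α/2)) :=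
    add_nonneg he.le (mul_nonneg h0.le (by linarith))
  calc _ ≤ (ε ^ (α/2) + h * ((1 + ε ^ ((1:ℝ)/2)) ^ α - ε ^ (α/2))) ^ (1/α) := by linarith
    _ ≤ (2 * h) ^ (1/α) := Real.rpow_le_rpow hnonneg hbase (by positivity)
    _ = 2 ^ (1/α) * h ^ (1/α) := Real.mul_rpow (by norm_num) h0.le
    _ ≤ 2 ^ (1/α) * h ^ k := by
      gcongr
      rw [← Real.rpow_natCast]
      exact Real.rpow_le_rpow_of_exponent_ge h0 h1 hkα
end

section
/- Let 0 < α ≤ 1. Then for every 0 < ε ≤ 1, every integer N ≥ 1 and every i with 1 ≤ i ≤ N, the mesh widths of the Liseikin mesh satisfy h_i ≤ 2 κ h, where κ = ((1+ε^{1/2})^α − ε^{α/2})/α; in particular h_i ≤ (2/α) h. -/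
/-- The tangent line inequality for the convex power `y ↦ y ^ p`, `1 ≤ p`. -/
theorem rpow_sub_rpow_le_mul_sub {x y p : ℝ} (hx : 0 ≤ x) (hy : 0 < y) (hp : 1 ≤ p) :
    y ^ p - x ^ p ≤ p * y ^ (p - 1) * (y - x) := by
  have hs : -1 ≤ x / y - 1 := by
    have := div_nonneg hx hy.le
    linarith
  have hb := one_add_mul_self_le_rpow_one_add hs hp
  rw [add_sub_cancel, Real.div_rpow hx hy.le, le_div_iff₀ (Real.rpow_pos_of_pos hy p)] at hb
  have hpow : y ^ p = y ^ (p - 1) * y := by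
    rw [← Real.rpow_add_one hy.ne', sub_add_cancel]
  have hexp : (1 + p * (x / y - 1)) * y ^ p = y ^ p + p * y ^ (p - 1) * (x - y) := by
    rw [hpow]
    field_simp
  linarith

/-- Increments of `t ↦ t ^ (1 / α)` below `b ^ α`, where `1 ≤ b ≤ 2`. -/
theorem rpow_one_div_sub_le {α b x y : ℝ} (hα0 : 0 < α) (hα1 : α ≤ 1) (hb1 : 1 ≤ b)
    (hb2 : b ≤ 2) (hx : 0 ≤ x) (hxy : x ≤ y) (hy : 0 < y) (hyb : y ≤ b ^ α) :
    y ^ (1 / α) - x ^ (1 / α) ≤ 2 / α * (y - x) := by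
  have hp : 1 ≤ 1 / α := (one_le_div hα0).2 hα1
  refine (rpow_sub_rpow_le_mul_sub hx hy hp).trans ?_
  refine mul_le_mul_of_nonneg_right ?_ (sub_nonneg.2 hxy)
  have hslope : y ^ (1 / α - 1) ≤ 2 := calc
    y ^ (1 / α - 1) ≤ (b ^ α) ^ (1 / α - 1) := Real.rpow_le_rpow hy.le hyb (by linarith)
    _ = b ^ (1 - α) := by
      rw [← Real.rpow_mul (by linarith), mul_sub, mul_one_div_cancel hα0.ne', mul_one]
    _ ≤ b ^ (1 : ℝ) := Real.rpow_le_rpow_of_exponent_le hb1 (by linarith)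
    _ ≤ 2 := by rwa [Real.rpow_one]
  calc 1 / α * y ^ (1 / α - 1) ≤ 1 / α * 2 := by gcongr
    _ = 2 / α := by ring

theorem liseikin_h_bound (α : ℝ) (hα0 : 0 < α) (hα1 : α ≤ 1) :
    ∀ ε : ℝ, 0 < ε → ε ≤ 1 → ∀ N : ℕ, 1 ≤ N → ∀ i : ℤ, 1 ≤ i → i ≤ N →
      liseikinH α ε N i ≤ 2 * (((1 + ε ^ ((1:ℝ)/2)) ^ α - ε ^ (α/2)) / α) * ((1:ℝ)/N) ∧
      liseikinH α ε N i ≤ (2/α) * ((1:ℝ)/N) := by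
  intro ε hε0 hε1 N hN i hi1 hiN
  have hNpos : (0 : ℝ) < N := by exact_mod_cast hN
  have hi1' : (1 : ℝ) ≤ i := by exact_mod_cast hi1
  have hiN' : (i : ℝ) ≤ N := by exact_mod_cast hiN
  have hs0 : 0 < ε ^ ((1 : ℝ) / 2) := Real.rpow_pos_of_pos hε0 _
  have hs1 : ε ^ ((1 : ℝ) / 2) ≤ 1 := Real.rpow_le_one hε0.le hε1 (by norm_num)
  have hA : ε ^ (α / 2) = (ε ^ ((1 : ℝ) / 2)) ^ α := by
    rw [← Real.rpow_mul hε0.le]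
    ring_nf
  have hξ0 : 0 ≤ (i : ℝ) / N := by positivity
  have hη0 : 0 ≤ ((i - 1 : ℤ) : ℝ) / N := by
    push_cast
    exact div_nonneg (by linarith) hNpos.le
  have hξ1 : (i : ℝ) / N ≤ 1 := (div_le_one hNpos).2 hiN'
  have hstep : (i : ℝ) / N - ((i - 1 : ℤ) : ℝ) / N = 1 / N := by
    push_cast
    ring
  simp only [liseikinH, liseikinX, liseikinPhi, if_pos hξ0, if_pos hη0]
  rw [hA]
  generalize ε ^ ((1 : ℝ) / 2) = s at *
  generalize (i : ℝ) / N = ξ at *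
  generalize ((i - 1 : ℤ) : ℝ) / N = η at *
  have hApos : 0 < s ^ α := Real.rpow_pos_of_pos hs0 α
  have hD0 : 0 ≤ (1 + s) ^ α - s ^ α :=
    sub_nonneg.2 (Real.rpow_le_rpow hs0.le (by linarith) hα0.le)
  have hD1 : (1 + s) ^ α - s ^ α ≤ 1 := by
    have := Real.rpow_add_le_add_rpow zero_le_one hs0.le hα0.le hα1
    rw [Real.one_rpow] at this
    linarith
  have hh : (0 : ℝ) ≤ 1 / N := by positivity
  have hηξ : η ≤ ξ := by linarith
  have hinc := rpow_one_div_sub_le (b := 1 + s) (x := s ^ α + η * ((1 + s) ^ α - s ^ α))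
    (y := s ^ α + ξ * ((1 + s) ^ α - s ^ α)) hα0 hα1 (by linarith) (by linarith)
    (by positivity) (by gcongr) (by positivity)
    (by linarith [mul_le_mul_of_nonneg_right hξ1 hD0])
  have hkey : (s ^ α + ξ * ((1 + s) ^ α - s ^ α)) ^ (1 / α) - s -
      ((s ^ α + η * ((1 + s) ^ α - s ^ α)) ^ (1 / α) - s) ≤
      2 * (((1 + s) ^ α - s ^ α) / α) * (1 / N) := by
    rw [← hstep]
    refine le_of_eq_of_le (by ring) (hinc.trans_eq (by ring))
  refine ⟨hkey, hkey.trans (mul_le_mul_of_nonneg_right ?_ hh)⟩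
  rw [← mul_div_assoc]
  gcongr
  linarith
end

section
/- Let α̂ > 0 and 0 < α ≤ min{α̂/2, 1/2}. Then there is a constant C, depending only on α and α̂, such that for every 0 < ε ≤ 1, every integer N ≥ 2 and every i with 2 ≤ i ≤ N: (h_i − h_{i−1}) (x_{i−1} + ε^{1/2})^{α̂−1} ≤ C h². -/
/-- The tangent line inequality for the convex function `x ↦ x ^ q`, `1 ≤ q`. -/
theorem rpow_tangent_le {q a b : ℝ} (hq : 1 ≤ q) (ha : 0 < a) (hb : 0 < b) :
    b ^ q + q * b ^ (q - 1) * (a - b) ≤ a ^ q := by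
  have h := one_add_mul_self_le_rpow_one_add (s := a / b - 1) (by linarith [div_pos ha hb]) hq
  rw [add_sub_cancel, Real.div_rpow ha.le hb.le, le_div_iff₀ (Real.rpow_pos_of_pos hb q)] at h
  have hbq : b ^ q = b ^ (q - 1) * b := by
    rw [← Real.rpow_add_one hb.ne', sub_add_cancel]
  calc b ^ q + q * b ^ (q - 1) * (a - b) = (1 + q * (a / b - 1)) * b ^ q := by
        rw [hbq]; field_simp
    _ ≤ a ^ q := h

/-- The second central difference of `x ↦ x ^ p`, `2 ≤ p`. -/
theorem rpow_second_difference_le {p m d : ℝ} (hp : 2 ≤ p) (hd : 0 ≤ d) (hdm : d < m) :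
    (m + d) ^ p - 2 * m ^ p + (m - d) ^ p
      ≤ 2 * p * (p - 1) * 2 ^ (p - 2) * (m ^ (p - 2) * d ^ 2) := by
  have hm : 0 < m := hd.trans_lt hdm
  have ha : 0 < m + d := by linarith
  have hb : 0 < m - d := by linarith
  have h1 := rpow_tangent_le (q := p) (by linarith) hm ha
  have h2 := rpow_tangent_le (q := p) (by linarith) hm hb
  have h3 := rpow_tangent_le (q := p - 1) (by linarith) hb ha
  rw [show p - 1 - 1 = p - 2 by ring] at h3
  have h4 : (m + d) ^ (p - 2) ≤ 2 ^ (p - 2) * m ^ (p - 2) := by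
    rw [← Real.mul_rpow two_pos.le hm.le]
    exact Real.rpow_le_rpow ha.le (by linarith) (by linarith)
  have h5 := mul_le_mul_of_nonneg_left h3 (show 0 ≤ p * d by positivity)
  have h6 := mul_le_mul_of_nonneg_left h4
    (show 0 ≤ 2 * p * (p - 1) * d ^ 2 by
      have : 0 ≤ p - 1 := by linarith
      positivity)
  linarith

theorem liseikinPhi_add_of_nonneg {α ε ξ : ℝ} (hξ : 0 ≤ ξ) :
    liseikinPhi α ε ξ + ε ^ ((1:ℝ)/2) =
      (ε ^ (α/2) + ξ * ((1 + ε ^ ((1:ℝ)/2)) ^ α - ε ^ (α/2))) ^ (1/α) := by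
  simp [liseikinPhi, hξ]

theorem liseikin_hdiff_weighted_bound (αhat α : ℝ)
    (hαhat : 0 < αhat) (hα0 : 0 < α) (hα : α ≤ min (αhat / 2) (1/2)) :
    ∃ C : ℝ, 0 < C ∧
      ∀ ε : ℝ, 0 < ε → ε ≤ 1 → ∀ N : ℕ, 2 ≤ N → ∀ i : ℤ, 2 ≤ i → i ≤ N →
        (liseikinH α ε N i - liseikinH α ε N (i-1))
            * (liseikinX α ε N (i-1) + ε ^ ((1:ℝ)/2)) ^ (αhat - 1)
          ≤ C * ((1:ℝ)/N) ^ 2 := by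
  have hα1 : α ≤ αhat / 2 := hα.trans (min_le_left _ _)
  have hα2 : α ≤ 1 / 2 := hα.trans (min_le_right _ _)
  have hp : 2 ≤ 1 / α := by rw [le_div_iff₀ hα0]; linarith
  have hr : 0 ≤ 1 / α * αhat - 2 := by
    rw [sub_nonneg, div_mul_eq_mul_div, le_div_iff₀ hα0]; linarith
  generalize hpdef : 1 / α = p at hp hr
  have hK : 0 < 2 * p * (p - 1) * (2:ℝ) ^ (p - 2) := by
    have : 0 < p - 1 := by linarith
    positivity
  refine ⟨2 * p * (p - 1) * 2 ^ (p - 2) * (2 ^ (p * αhat - 2) * 4), by positivity, ?_⟩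
  intro ε hε hε1 N hN i hi hiN
  have hN0 : (0:ℝ) < N := by exact_mod_cast (by omega : 0 < N)
  have hi' : (2:ℝ) ≤ i := by exact_mod_cast hi
  have hiN' : (i:ℝ) ≤ N := by exact_mod_cast hiN
  have e1 := liseikinPhi_add_of_nonneg (α := α) (ε := ε) (ξ := (i:ℝ) / N) (by positivity)
  have e2 := liseikinPhi_add_of_nonneg (α := α) (ε := ε) (ξ := ((i:ℝ) - 1) / N)
    (div_nonneg (by linarith) hN0.le)
  have e3 := liseikinPhi_add_of_nonneg (α := α) (ε := ε) (ξ := ((i:ℝ) - 1 - 1) / N)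
    (div_nonneg (by linarith) hN0.le)
  simp only [liseikinH, liseikinX, Int.cast_sub, Int.cast_one]
  rw [hpdef] at e1 e2 e3
  have hs : 0 < ε ^ (α/2) := Real.rpow_pos_of_pos hε _
  have hr0 : 0 < ε ^ ((1:ℝ)/2) := Real.rpow_pos_of_pos hε _
  have hr1 : ε ^ ((1:ℝ)/2) ≤ 1 := Real.rpow_le_one hε.le hε1 (by norm_num)
  have hsr : ε ^ (α/2) ≤ (1 + ε ^ ((1:ℝ)/2)) ^ α := by
    rw [show α / 2 = 1 / 2 * α by ring, Real.rpow_mul hε.le]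
    exact Real.rpow_le_rpow hr0.le (by linarith) hα0.le
  have hT : (1 + ε ^ ((1:ℝ)/2)) ^ α ≤ 2 :=
    calc (1 + ε ^ ((1:ℝ)/2)) ^ α ≤ (1 + ε ^ ((1:ℝ)/2)) ^ (1:ℝ) :=
          Real.rpow_le_rpow_of_exponent_le (by linarith) (by linarith)
      _ ≤ 2 := by rw [Real.rpow_one]; linarith
  generalize ε ^ (α/2) = s at *
  generalize (1 + ε ^ ((1:ℝ)/2)) ^ α = T at *
  generalize ε ^ ((1:ℝ)/2) = r at *
  obtain ⟨d, hd⟩ : ∃ d, d = (T - s) / N := ⟨_, rfl⟩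
  obtain ⟨m, hm⟩ : ∃ m, m = s + ((i:ℝ) - 1) / N * (T - s) := ⟨_, rfl⟩
  have hd0 : 0 ≤ d := hd ▸ div_nonneg (by linarith) hN0.le
  have hdm : d < m := by
    have : m = s + (i - 1) * d := by rw [hm, hd]; ring
    nlinarith
  have hm0 : 0 < m := hd0.trans_lt hdm
  have hm2 : m ≤ 2 := by
    have : ((i:ℝ) - 1) / N ≤ 1 := by rw [div_le_one hN0]; linarith
    nlinarith
  have hd2 : d ^ 2 ≤ 4 * (1 / (N:ℝ)) ^ 2 :=
    calc d ^ 2 ≤ (2 / (N:ℝ)) ^ 2 := by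
          have : d ≤ 2 / N := by rw [hd]; gcongr; linarith
          gcongr
      _ = 4 * (1 / (N:ℝ)) ^ 2 := by ring
  rw [show s + (i:ℝ) / N * (T - s) = m + d by rw [hm, hd]; ring] at e1
  rw [← hm] at e2
  rw [show s + ((i:ℝ) - 1 - 1) / N * (T - s) = m - d by rw [hm, hd]; ring] at e3
  rw [e2, ← Real.rpow_mul hm0.le]
  have hpow : m ^ (p - 2) * m ^ (p * (αhat - 1)) ≤ 2 ^ (p * αhat - 2) := by
    rw [← Real.rpow_add hm0, show p - 2 + p * (αhat - 1) = p * αhat - 2 by ring]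
    exact Real.rpow_le_rpow hm0.le hm2 hr
  calc _ = ((m + d) ^ p - 2 * m ^ p + (m - d) ^ p) * m ^ (p * (αhat - 1)) := by
        rw [← e1, ← e2, ← e3]; ring
    _ ≤ 2 * p * (p - 1) * 2 ^ (p - 2) * (m ^ (p - 2) * d ^ 2) * m ^ (p * (αhat - 1)) := by
        gcongr
        exact rpow_second_difference_le hp hd0 hdm
    _ = 2 * p * (p - 1) * 2 ^ (p - 2) * (m ^ (p - 2) * m ^ (p * (αhat - 1)) * d ^ 2) := by
        ring
    _ ≤ 2 * p * (p - 1) * 2 ^ (p - 2) * (2 ^ (p * αhat - 2) * (4 * (1 / (N:ℝ)) ^ 2)) := by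
        gcongr
    _ = _ := by ring
end

section
/- Let k ≥ 1 be an integer, λ ∈ (0, k+1), 0 < ε ≤ 1, and let u ∈ C^{k+1}([−1,1]) satisfy |u^{(i)}(x)| ≤ C_u (1 + (ε^{1/2} + |x|)^{λ−i}) for all 0 ≤ i ≤ k+1 and x ∈ [−1,1]. Let u_I be the degree-k piecewise Lagrange interpolant of u on the Liseikin mesh with parameter α satisfying 0 < α ≤ min{λ/(k+1), 1/(2(k+1))}. Then there is a constant C, depending only on α, λ, k, C_u and the interpolation nodes, but not on ε or N, such that the L²(−1,1) interpolation error satisfies ‖u − u_I‖ ≤ C N^{−(k+1)}. -/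
/-- `uI` is the degree-`k` piecewise Lagrange interpolant of `u` on the mesh `x`
with reference nodes `x̂_0, …, x̂_k`: it is continuous on `[-1,1]`, on every mesh
interval `[x_{i-1}, x_i]` it coincides with a polynomial of degree at most `k`,
and it agrees with `u` at the points `x_{i-1} + h_i x̂_j`, `j = 0, …, k`. -/
def IsLagrangeInterpolant (x : ℤ → ℝ) (N k : ℕ) (xhat : ℕ → ℝ) (u uI : ℝ → ℝ) : Prop :=
  ContinuousOn uI (Set.Icc (-1) 1) ∧
  ∀ i : ℤ, -(N:ℤ) < i → i ≤ N →
    (∃ p : Polynomial ℝ, p.natDegree ≤ k ∧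
      ∀ y ∈ Set.Icc (x (i-1)) (x i), uI y = p.eval y) ∧
    ∀ j : ℕ, j ≤ k →
      uI (x (i-1) + (x i - x (i-1)) * xhat j) = u (x (i-1) + (x i - x (i-1)) * xhat j)

open Polynomial in
/-- Stability of polynomial interpolation: the Lebesgue constant of distinct nodes on `[0,1]`. -/
lemma exists_lebesgue_constant (k : ℕ) (v : ℕ → ℝ)
    (hv : Set.InjOn v (Finset.range (k + 1) : Set ℕ)) :
    ∃ L : ℝ, 0 ≤ L ∧ ∀ g : ℝ[X], g.natDegree ≤ k → ∀ η : ℝ,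
      (∀ j ≤ k, |g.eval (v j)| ≤ η) → ∀ t ∈ Set.Icc (0 : ℝ) 1, |g.eval t| ≤ L * η := by
  have hb : ∀ j : ℕ, ∃ B : ℝ, ∀ t ∈ Set.Icc (0 : ℝ) 1,
      ‖(Lagrange.basis (Finset.range (k + 1)) v j).eval t‖ ≤ B := fun j =>
    isCompact_Icc.exists_bound_of_continuousOn (Polynomial.continuous _).continuousOn
  choose B hB using hb
  have hB0 : ∀ j, 0 ≤ B j := fun j => (norm_nonneg _).trans (hB j 0 (by simp))
  refine ⟨∑ j ∈ Finset.range (k + 1), B j, Finset.sum_nonneg fun j _ => hB0 j, ?_⟩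
  intro g hg η hη t ht
  have hdeg : g.degree < (Finset.range (k + 1)).card := by
    rw [Finset.card_range]
    exact (Polynomial.degree_le_of_natDegree_le hg).trans_lt (by exact_mod_cast Nat.lt_succ_self k)
  rw [Lagrange.eq_interpolate hv hdeg, Lagrange.interpolate_apply, Polynomial.eval_finsetSum,
    Finset.sum_mul]
  refine (Finset.abs_sum_le_sum_abs _ _).trans (Finset.sum_le_sum fun j hj => ?_)
  rw [Polynomial.eval_mul, Polynomial.eval_C, abs_mul, mul_comm]
  exact mul_le_mul (hB j t ht) (hη j (by simpa [Nat.lt_succ_iff] using hj)) (abs_nonneg _) (hB0 j)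

open Polynomial in
/-- Lebesgue's lemma on `[a, b]`: interpolation is quasi-optimal among polynomials of
degree at most `k`. -/
lemma abs_sub_interpolant_le {k : ℕ} {v : ℕ → ℝ} {L : ℝ}
    (hv : ∀ j ≤ k, v j ∈ Set.Icc (0 : ℝ) 1)
    (hL : ∀ g : ℝ[X], g.natDegree ≤ k → ∀ η : ℝ,
      (∀ j ≤ k, |g.eval (v j)| ≤ η) → ∀ t ∈ Set.Icc (0 : ℝ) 1, |g.eval t| ≤ L * η)
    {a b η : ℝ} (hab : a < b) {f : ℝ → ℝ} {p q : ℝ[X]}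
    (hp : p.natDegree ≤ k) (hq : q.natDegree ≤ k)
    (hpf : ∀ j ≤ k, p.eval (a + (b - a) * v j) = f (a + (b - a) * v j))
    (hfq : ∀ y ∈ Set.Icc a b, |f y - q.eval y| ≤ η) {y : ℝ} (hy : y ∈ Set.Icc a b) :
    |f y - p.eval y| ≤ (1 + L) * η := by
  have hba : 0 < b - a := sub_pos.2 hab
  set g : ℝ[X] := (p - q).comp (C a + C (b - a) * X) with hg
  have hgev : ∀ t, g.eval t = p.eval (a + (b - a) * t) - q.eval (a + (b - a) * t) := by
    intro t; simp [hg, eval_comp]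
  have hgdeg : g.natDegree ≤ k := by
    refine natDegree_comp_le.trans ?_
    have h1 : (C a + C (b - a) * X : ℝ[X]).natDegree ≤ 1 := by
      rw [add_comm]; exact natDegree_linear_le
    calc (p - q).natDegree * (C a + C (b - a) * X : ℝ[X]).natDegree ≤ k * 1 :=
          Nat.mul_le_mul ((natDegree_sub_le _ _).trans (max_le hp hq)) h1
      _ = k := mul_one k
  have hnode : ∀ j ≤ k, |g.eval (v j)| ≤ η := by
    intro j hj
    rw [hgev, hpf j hj]
    refine hfq _ ⟨?_, ?_⟩
    · nlinarith [(hv j hj).1]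
    · nlinarith [(hv j hj).2]
  have ht : (y - a) / (b - a) ∈ Set.Icc (0 : ℝ) 1 :=
    ⟨div_nonneg (by linarith [hy.1]) hba.le, (div_le_one hba).2 (by linarith [hy.2])⟩
  have h := hL g hgdeg η hnode _ ht
  rw [hgev, mul_div_cancel₀ _ hba.ne', add_sub_cancel] at h
  calc |f y - p.eval y| = |(f y - q.eval y) - (p.eval y - q.eval y)| := by ring_nf
    _ ≤ |f y - q.eval y| + |p.eval y - q.eval y| := abs_sub _ _
    _ ≤ η + L * η := add_le_add (hfq y hy) h
    _ = (1 + L) * η := by ring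

open Polynomial in
/-- A `C^{k+1}` function is approximated by a polynomial of degree `k` to order `k + 1`. -/
lemma exists_polynomial_abs_sub_le {k : ℕ} {f : ℝ → ℝ} {s : Set ℝ} {a b M : ℝ} (hab : a < b)
    (hs : UniqueDiffOn ℝ s) (habs : Set.Icc a b ⊆ s) (hf : ContDiffOn ℝ (k + 1 : ℕ) f s)
    (hM : ∀ y ∈ Set.Icc a b, |iteratedDerivWithin (k + 1) f s y| ≤ M) :
    ∃ q : ℝ[X], q.natDegree ≤ k ∧
      ∀ y ∈ Set.Icc a b, |f y - q.eval y| ≤ M * (b - a) ^ (k + 1) := by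
  refine ⟨∑ j ∈ Finset.range (k + 1),
    C ((j.factorial : ℝ)⁻¹ * iteratedDerivWithin j f (Set.Icc a b) a) * (X - C a) ^ j, ?_, ?_⟩
  · refine natDegree_sum_le_of_forall_le _ _ fun j hj => ?_
    refine (natDegree_C_mul_le _ _).trans ?_
    rw [natDegree_pow, natDegree_X_sub_C, mul_one]
    exact Nat.lt_succ_iff.1 (Finset.mem_range.1 hj)
  · intro y hy
    have hM0 : 0 ≤ M := (abs_nonneg _).trans (hM a ⟨le_rfl, hab.le⟩)
    have hbound : ∀ z ∈ Set.Icc a b, ‖iteratedDerivWithin (k + 1) f (Set.Icc a b) z‖ ≤ M := by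
      intro z hz
      have : iteratedDerivWithin (k + 1) f (Set.Icc a b) z
          = iteratedDerivWithin (k + 1) f s z := by
        simp only [iteratedDerivWithin]
        rw [iteratedFDerivWithin_subset habs (uniqueDiffOn_Icc hab) hs hf hz]
      rw [this]
      exact hM z hz
    have h := taylor_mean_remainder_bound hab.le
      (by exact_mod_cast hf.mono habs : ContDiffOn ℝ (k + 1) f (Set.Icc a b)) hy hbound
    rw [taylor_within_apply, Real.norm_eq_abs] at h
    have he : (∑ j ∈ Finset.range (k + 1),
        C ((j.factorial : ℝ)⁻¹ * iteratedDerivWithin j f (Set.Icc a b) a) * (X - C a) ^ j).eval y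
        = ∑ j ∈ Finset.range (k + 1),
          ((j.factorial : ℝ)⁻¹ * (y - a) ^ j) • iteratedDerivWithin j f (Set.Icc a b) a := by
      rw [eval_finsetSum]
      refine Finset.sum_congr rfl fun j _ => ?_
      simp only [eval_mul, eval_C, eval_pow, eval_sub, eval_X, smul_eq_mul]
      ring
    rw [he]
    refine h.trans ?_
    refine (div_le_self (mul_nonneg hM0 (pow_nonneg (by linarith [hy.1]) _))
      (by exact_mod_cast Nat.one_le_iff_ne_zero.2 k.factorial_ne_zero)).trans ?_
    gcongr
    · linarith [hy.1]
    · exact hy.2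

/-- Mesh-width estimate: if `Z ^ α - z ^ α ≤ 1 / N ≤ z ^ α`, then `Z - z ≲ z ^ (1 - α) / N`. -/
lemma sub_le_of_rpow_le {α z Z N : ℝ} (hα0 : 0 < α) (hα1 : α ≤ 1) (hz : 0 < z) (hzZ : z ≤ Z)
    (hZ : Z ^ α ≤ z ^ α + 1 / N) (hzN : 1 / N ≤ z ^ α) :
    Z - z ≤ (1 / α * 2 ^ (1 / α - 1)) * z ^ (1 - α) / N := by
  have hZ0 : 0 < Z := hz.trans_le hzZ
  have hp : 1 ≤ 1 / α := (one_le_div hα0).2 hα1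
  have hbern := one_add_mul_self_le_rpow_one_add (s := z ^ α / Z ^ α - 1)
    (by have : 0 ≤ z ^ α / Z ^ α := by positivity
        linarith) hp
  have hrz : (z ^ α) ^ (1 / α) = z := by
    rw [← Real.rpow_mul hz.le, mul_one_div_cancel hα0.ne', Real.rpow_one]
  have hrZ : (Z ^ α) ^ (1 / α) = Z := by
    rw [← Real.rpow_mul hZ0.le, mul_one_div_cancel hα0.ne', Real.rpow_one]
  rw [add_sub_cancel, Real.div_rpow (by positivity) (by positivity), hrz, hrZ,
    le_div_iff₀ hZ0] at hbern
  have hZa : 0 < Z ^ α := by positivity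
  have hsplit : Z ^ (1 - α) = Z / Z ^ α := by
    rw [Real.rpow_sub hZ0, Real.rpow_one]
  have h1 : Z - z ≤ 1 / α * Z ^ (1 - α) * (Z ^ α - z ^ α) := by
    have : 1 / α * Z ^ (1 - α) * (Z ^ α - z ^ α) = -(1 / α * (z ^ α / Z ^ α - 1) * Z) := by
      rw [hsplit]; field_simp; ring
    rw [this]; linarith
  have h2 : Z ^ (1 - α) ≤ 2 ^ (1 / α - 1) * z ^ (1 - α) := by
    have e : ∀ w : ℝ, 0 < w → w ^ (1 - α) = (w ^ α) ^ (1 / α - 1) := by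
      intro w hw
      rw [← Real.rpow_mul hw.le]
      congr 1
      field_simp
    rw [e Z hZ0, e z hz, ← Real.mul_rpow (by norm_num) (by positivity)]
    exact Real.rpow_le_rpow hZa.le (by linarith) (by linarith)
  calc Z - z ≤ 1 / α * Z ^ (1 - α) * (Z ^ α - z ^ α) := h1
    _ ≤ 1 / α * (2 ^ (1 / α - 1) * z ^ (1 - α)) * (1 / N) := by
        gcongr
        · exact sub_nonneg.2 (Real.rpow_le_rpow hz.le hzZ hα0.le)
        · linarith
    _ = _ := by ring

/-- On a graded element the weight `1 + z ^ (lam - (k + 1))` is compensated by the mesh width. -/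
lemma weight_mul_width_pow_le {k : ℕ} {lam α K z h N : ℝ} (hα1 : α ≤ 1)
    (hαlam : α * (k + 1) ≤ lam) (hz : 0 < z) (hz2 : z ≤ 2) (hh : 0 ≤ h)
    (hK : 0 ≤ K) (hN : 0 < N) (hhz : h ≤ K * z ^ (1 - α) / N) :
    (1 + z ^ (lam - (k + 1))) * h ^ (k + 1)
      ≤ K ^ (k + 1) * (2 ^ ((1 - α) * (k + 1)) + 2 ^ (lam - α * (k + 1))) / N ^ (k + 1) := by
  have hpow : (z ^ (1 - α)) ^ (k + 1) = z ^ ((1 - α) * (k + 1)) := by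
    rw [← Real.rpow_natCast, ← Real.rpow_mul hz.le]
    push_cast
    rfl
  have hk : (0 : ℝ) ≤ (1 - α) * (k + 1) := mul_nonneg (by linarith) (by positivity)
  have h1 : z ^ ((1 - α) * (k + 1)) ≤ 2 ^ ((1 - α) * (k + 1)) :=
    Real.rpow_le_rpow hz.le hz2 hk
  have h2 : z ^ (lam - (k + 1)) * z ^ ((1 - α) * (k + 1)) ≤ 2 ^ (lam - α * (k + 1)) := by
    rw [← Real.rpow_add hz]
    have : lam - (k + 1) + (1 - α) * (k + 1) = lam - α * (k + 1) := by ring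
    rw [this]
    exact Real.rpow_le_rpow hz.le hz2 (by linarith)
  calc (1 + z ^ (lam - (k + 1))) * h ^ (k + 1)
      ≤ (1 + z ^ (lam - (k + 1))) * (K * z ^ (1 - α) / N) ^ (k + 1) := by gcongr
    _ = K ^ (k + 1) * (z ^ ((1 - α) * (k + 1)) +
          z ^ (lam - (k + 1)) * z ^ ((1 - α) * (k + 1))) / N ^ (k + 1) := by
        rw [div_pow, mul_pow, hpow]; ring
    _ ≤ _ := by gcongr

open Polynomial in
/-- Interpolation error on one mesh element: either of optimal order, or bounded on an element
lying in an `N ^ (-1 / α)`-neighbourhood of the origin. -/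
lemma abs_sub_le_on_element {k : ℕ} {v : ℕ → ℝ} {L lam α Cu s N a b z : ℝ}
    (hv : ∀ j ≤ k, v j ∈ Set.Icc (0 : ℝ) 1) (hL0 : 0 ≤ L)
    (hL : ∀ g : ℝ[X], g.natDegree ≤ k → ∀ η : ℝ,
      (∀ j ≤ k, |g.eval (v j)| ≤ η) → ∀ t ∈ Set.Icc (0 : ℝ) 1, |g.eval t| ≤ L * η)
    (hα0 : 0 < α) (hα1 : α ≤ 1) (hlam0 : 0 < lam) (hlam1 : lam < k + 1)
    (hαlam : α * (k + 1) ≤ lam) (hCu : 0 ≤ Cu) (hN : 0 < N) (hs : 0 ≤ s)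
    (hab : a < b) (hsub : Set.Icc a b ⊆ Set.Icc (-1) 1) (hz : 0 < z)
    (hzw : ∀ w ∈ Set.Icc a b, z ≤ s + |w| ∧ s + |w| ≤ z + (b - a))
    (hZ2 : z + (b - a) ≤ 2) (hZ : (z + (b - a)) ^ α ≤ z ^ α + 1 / N)
    {u : ℝ → ℝ} (hu : ContDiffOn ℝ (k + 1 : ℕ) u (Set.Icc (-1) 1))
    (hbd : ∀ i : ℕ, i ≤ k + 1 → ∀ y ∈ Set.Icc (-1 : ℝ) 1,
      |iteratedDerivWithin i u (Set.Icc (-1) 1) y| ≤ Cu * (1 + (s + |y|) ^ (lam - i)))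
    {p : ℝ[X]} (hp : p.natDegree ≤ k)
    (hpu : ∀ j ≤ k, p.eval (a + (b - a) * v j) = u (a + (b - a) * v j))
    {y : ℝ} (hy : y ∈ Set.Icc a b) :
    |u y - p.eval y| ≤ (1 + L) * (Cu * ((1 / α * 2 ^ (1 / α - 1)) ^ (k + 1) *
        (2 ^ ((1 - α) * (k + 1)) + 2 ^ (lam - α * (k + 1))))) / N ^ (k + 1) ∨
      (|y| ≤ (2 / N) ^ (1 / α) ∧ |u y - p.eval y| ≤ (1 + L) * (Cu * (1 + 2 ^ lam))) := by
  have hba : 0 < b - a := sub_pos.2 hab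
  rcases le_or_gt (1 / N) (z ^ α) with hcase | hcase
  · left
    have hwidth := sub_le_of_rpow_le hα0 hα1 hz (by linarith) hZ hcase
    rw [add_sub_cancel_left] at hwidth
    have hM : ∀ w ∈ Set.Icc a b, |iteratedDerivWithin (k + 1) u (Set.Icc (-1) 1) w|
        ≤ Cu * (1 + z ^ (lam - (k + 1))) := by
      intro w hw
      have h := hbd (k + 1) le_rfl w (hsub hw)
      push_cast at h
      refine h.trans ?_
      have := Real.rpow_le_rpow_of_nonpos hz (hzw w hw).1
        (by linarith : lam - (k + 1) ≤ 0)
      gcongr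
    obtain ⟨q, hq, hfq⟩ := exists_polynomial_abs_sub_le hab
      (uniqueDiffOn_Icc (by norm_num)) hsub hu hM
    refine (abs_sub_interpolant_le hv hL hab hp hq hpu hfq hy).trans ?_
    have hw := weight_mul_width_pow_le (k := k) hα1 hαlam hz (by linarith) hba.le
      (by positivity) hN hwidth
    rw [mul_div_assoc, mul_assoc Cu, mul_div_assoc Cu]
    gcongr
  · right
    constructor
    · have h1 : s + |y| ≤ (2 / N) ^ (1 / α) := by
        refine (hzw y hy).2.trans ?_
        have hZ0 : 0 ≤ z + (b - a) := by positivity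
        calc z + (b - a) = ((z + (b - a)) ^ α) ^ (1 / α) := by
              rw [← Real.rpow_mul hZ0, mul_one_div_cancel hα0.ne', Real.rpow_one]
          _ ≤ (2 / N) ^ (1 / α) := by
              refine Real.rpow_le_rpow (by positivity) (hZ.trans ?_) (by positivity)
              have : 2 / N = 1 / N + 1 / N := by ring
              linarith
      linarith
    · refine abs_sub_interpolant_le hv hL hab hp (q := 0) (by simp) hpu (fun w hw => ?_) hy
      have h := hbd 0 (Nat.zero_le _) w (hsub hw)
      simp only [iteratedDerivWithin_zero, Nat.cast_zero, sub_zero] at h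
      rw [Polynomial.eval_zero, sub_zero]
      refine h.trans ?_
      have := Real.rpow_le_rpow (by positivity) ((hzw w hw).2.trans hZ2) hlam0.le
      gcongr

/-- The shifted Liseikin node `s + φ(n / N)`, where `s = ε ^ (1 / 2)` and `n ≥ 0`. -/
noncomputable def liseikinShifted (α s : ℝ) (N n : ℕ) : ℝ :=
  (s ^ α + (n : ℝ) / N * ((1 + s) ^ α - s ^ α)) ^ (1 / α)

lemma liseikinX_natCast {α ε : ℝ} (hε : 0 ≤ ε) (N n : ℕ) :
    liseikinX α ε N (n : ℤ)
      = liseikinShifted α (ε ^ ((1 : ℝ) / 2)) N n - ε ^ ((1 : ℝ) / 2) := by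
  have h0 : (0 : ℝ) ≤ (n : ℝ) / N := by positivity
  have he : (ε ^ ((1 : ℝ) / 2)) ^ α = ε ^ (α / 2) := by
    rw [← Real.rpow_mul hε]; ring_nf
  simp only [liseikinX, liseikinPhi, liseikinShifted, Int.cast_natCast, if_pos h0, he]

lemma liseikinShifted_zero {α s : ℝ} (hα : 0 < α) (hs : 0 ≤ s) (N : ℕ) :
    liseikinShifted α s N 0 = s := by
  simp [liseikinShifted, ← Real.rpow_mul hs, hα.ne']

lemma liseikinShifted_self {α s : ℝ} (hα : 0 < α) (hs : 0 ≤ s) {N : ℕ} (hN : N ≠ 0) :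
    liseikinShifted α s N N = 1 + s := by
  have h1 : (N : ℝ) / N = 1 := div_self (by exact_mod_cast hN)
  rw [liseikinShifted, h1, one_mul, add_sub_cancel, ← Real.rpow_mul (by positivity),
    mul_one_div_cancel hα.ne', Real.rpow_one]

lemma liseikinX_neg_natCast {α ε : ℝ} (hα : 0 < α) (hε : 0 ≤ ε) (N n : ℕ) :
    liseikinX α ε N (-(n : ℤ))
      = ε ^ ((1 : ℝ) / 2) - liseikinShifted α (ε ^ ((1 : ℝ) / 2)) N n := by
  have he : (ε ^ ((1 : ℝ) / 2)) ^ α = ε ^ (α / 2) := by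
    rw [← Real.rpow_mul hε]; ring_nf
  by_cases h : (0 : ℝ) ≤ -(n : ℝ) / N
  · have h0 : (n : ℝ) / N = 0 := by
      have : (0 : ℝ) ≤ (n : ℝ) / N := by positivity
      rw [neg_div] at h
      linarith
    have h1 : (ε ^ (α / 2)) ^ α⁻¹ = ε ^ ((1 : ℝ) / 2) := by
      rw [← he, ← Real.rpow_mul (by positivity), mul_inv_cancel₀ hα.ne', Real.rpow_one]
    simp only [one_div] at h1 he
    simp [liseikinX, liseikinPhi, liseikinShifted, neg_div, h0, he, h1]
  · have h' : ¬ (0 : ℝ) ≤ -((n : ℝ) / N) := by rwa [← neg_div]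
    simp only [liseikinX, liseikinPhi, liseikinShifted, he, Int.cast_neg, Int.cast_natCast,
      neg_div, neg_neg, if_neg h']

lemma liseikinShifted_strictMono {α s : ℝ} (hα : 0 < α) (hs : 0 ≤ s) {N : ℕ} (hN : N ≠ 0) :
    StrictMono (liseikinShifted α s N) := by
  intro m n hmn
  have hD : 0 < (1 + s) ^ α - s ^ α :=
    sub_pos.2 (Real.rpow_lt_rpow hs (by linarith) hα)
  have hN' : (0 : ℝ) < N := by exact_mod_cast Nat.pos_of_ne_zero hN
  have hmn' : (m : ℝ) < n := by exact_mod_cast hmn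
  refine Real.rpow_lt_rpow (by positivity) ?_ (by positivity)
  gcongr

lemma liseikinShifted_rpow {α s : ℝ} (hα : 0 < α) (hs : 0 ≤ s) (N n : ℕ) :
    liseikinShifted α s N n ^ α = s ^ α + (n : ℝ) / N * ((1 + s) ^ α - s ^ α) := by
  have hD : 0 ≤ (1 + s) ^ α - s ^ α :=
    sub_nonneg.2 (Real.rpow_le_rpow hs (by linarith) hα.le)
  rw [liseikinShifted, ← Real.rpow_mul (by positivity), one_div_mul_cancel hα.ne', Real.rpow_one]

lemma liseikinShifted_succ_rpow_le {α s : ℝ} (hα : 0 < α) (hα1 : α ≤ 1) (hs : 0 ≤ s)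
    (N n : ℕ) :
    liseikinShifted α s N (n + 1) ^ α ≤ liseikinShifted α s N n ^ α + 1 / N := by
  rw [liseikinShifted_rpow hα hs, liseikinShifted_rpow hα hs]
  have hD : (1 + s) ^ α - s ^ α ≤ 1 := by
    have := Real.rpow_add_le_add_rpow zero_le_one hs hα.le hα1
    rw [Real.one_rpow] at this
    linarith
  have h1 : 1 / (N : ℝ) * ((1 + s) ^ α - s ^ α) ≤ 1 / N * 1 := by gcongr
  push_cast
  rw [add_div, add_mul]
  linarith

lemma exists_mem_consecutive {Z : ℕ → ℝ} {w : ℝ} (h0 : Z 0 ≤ w) :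
    ∀ N : ℕ, w ≤ Z (N + 1) → ∃ n ≤ N, Z n ≤ w ∧ w ≤ Z (n + 1)
  | 0, h => ⟨0, le_rfl, h0, h⟩
  | N + 1, h => by
    rcases le_total w (Z (N + 1)) with h' | h'
    · obtain ⟨n, hn, hw⟩ := exists_mem_consecutive h0 N h'
      exact ⟨n, hn.trans N.le_succ, hw⟩
    · exact ⟨N + 1, le_rfl, h', h⟩

/-- Every point of `[-1, 1]` lies in a mesh interval, on which the weight `ε ^ (1 / 2) + |w|`
ranges over an interval of the same length and graded in the `α`-th power. -/
lemma exists_liseikin_element {α ε : ℝ} (hα : 0 < α) (hα1 : α ≤ 1) (hε : 0 < ε) (hε1 : ε ≤ 1)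
    {N : ℕ} (hN : N ≠ 0) {y : ℝ} (hy : y ∈ Set.Icc (-1 : ℝ) 1) :
    ∃ i : ℤ, -(N : ℤ) < i ∧ i ≤ N ∧ ∃ a b z : ℝ,
      a = liseikinX α ε N (i - 1) ∧ b = liseikinX α ε N i ∧ a < b ∧
      Set.Icc a b ⊆ Set.Icc (-1) 1 ∧ y ∈ Set.Icc a b ∧ 0 < z ∧
      (∀ w ∈ Set.Icc a b, z ≤ ε ^ ((1 : ℝ) / 2) + |w| ∧
        ε ^ ((1 : ℝ) / 2) + |w| ≤ z + (b - a)) ∧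
      z + (b - a) ≤ 2 ∧ (z + (b - a)) ^ α ≤ z ^ α + 1 / N := by
  set s : ℝ := ε ^ ((1 : ℝ) / 2) with hs_def
  have hs : 0 < s := Real.rpow_pos_of_pos hε _
  have hs1 : s ≤ 1 := Real.rpow_le_one hε.le hε1 (by norm_num)
  set Z := liseikinShifted α s N with hZ_def
  have hmono : StrictMono Z := liseikinShifted_strictMono hα hs.le hN
  have hZ0 : Z 0 = s := liseikinShifted_zero hα hs.le N
  have hZN : Z N = 1 + s := liseikinShifted_self hα hs.le hN
  have hNs : N - 1 + 1 = N := Nat.sub_add_cancel (Nat.pos_of_ne_zero hN)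
  obtain ⟨n, hn, hn1, hn2⟩ := exists_mem_consecutive (Z := Z) (w := s + |y|)
    (by rw [hZ0]; linarith [abs_nonneg y]) (N - 1)
    (by rw [hNs, hZN]; linarith [abs_le.2 hy])
  have hnN : n + 1 ≤ N := by omega
  have hlt : Z n < Z (n + 1) := hmono n.lt_succ_self
  have hsn : s ≤ Z n := hZ0 ▸ hmono.monotone n.zero_le
  have hn1N : Z (n + 1) ≤ 1 + s := hZN ▸ hmono.monotone hnN
  have hgrade := liseikinShifted_succ_rpow_le hα hα1 hs.le N n
  rw [← hZ_def] at hgrade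
  rcases le_or_gt 0 y with h0 | h0
  · rw [abs_of_nonneg h0] at hn1 hn2
    have hx1 : liseikinX α ε N ((n + 1 : ℕ) : ℤ) = Z (n + 1) - s := liseikinX_natCast hε.le _ _
    have hx0 : liseikinX α ε N (((n + 1 : ℕ) : ℤ) - 1) = Z n - s := by
      rw [← liseikinX_natCast hε.le]; push_cast; ring_nf
    have hlen : Z n + (Z (n + 1) - s - (Z n - s)) = Z (n + 1) := by ring
    refine ⟨(n + 1 : ℕ), by omega, by omega, Z n - s, Z (n + 1) - s, Z n, hx0.symm, hx1.symm,
      by linarith, fun w hw => ⟨by linarith [hw.1], by linarith [hw.2]⟩,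
      ⟨by linarith, by linarith⟩, by linarith, fun w hw => ?_, by linarith, by rwa [hlen]⟩
    rw [hlen, abs_of_nonneg (by linarith [hw.1])]
    exact ⟨by linarith [hw.1], by linarith [hw.2]⟩
  · rw [abs_of_neg h0] at hn1 hn2
    have hx1 : liseikinX α ε N (-(n : ℤ)) = s - Z n := liseikinX_neg_natCast hα hε.le _ _
    have hx0 : liseikinX α ε N (-(n : ℤ) - 1) = s - Z (n + 1) := by
      rw [← liseikinX_neg_natCast hα hε.le]; push_cast; ring_nf
    have hlen : Z n + (s - Z n - (s - Z (n + 1))) = Z (n + 1) := by ring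
    refine ⟨-(n : ℤ), by omega, by omega, s - Z (n + 1), s - Z n, Z n, hx0.symm, hx1.symm,
      by linarith, fun w hw => ⟨by linarith [hw.1], by linarith [hw.2]⟩,
      ⟨by linarith, by linarith⟩, by linarith, fun w hw => ?_, by linarith, by rwa [hlen]⟩
    rw [hlen, abs_of_nonpos (by linarith [hw.2])]
    exact ⟨by linarith [hw.2], by linarith [hw.1]⟩

/-- `L²` bound for a function that is at most `A` everywhere on `[-1, 1]` outside `[-δ, δ]` and at
most `B` on `[-δ, δ]`. -/
lemma integral_sq_le_of_dichotomy {e : ℝ → ℝ} {A B δ : ℝ} (he : ContinuousOn e (Set.Icc (-1) 1))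
    (hδ : 0 ≤ δ) (h : ∀ y ∈ Set.Icc (-1 : ℝ) 1, |e y| ≤ A ∨ (|y| ≤ δ ∧ |e y| ≤ B)) :
    ∫ y in (-1 : ℝ)..1, e y ^ 2 ≤ 2 * A ^ 2 + 2 * δ * B ^ 2 := by
  have hI : IntervalIntegrable (fun y => e y ^ 2) MeasureTheory.volume (-1) 1 :=
    ((he.pow 2).mono (by rw [Set.uIcc_of_le (by norm_num)])).intervalIntegrable
  have hind : MeasureTheory.Integrable
      ((Set.Icc (-δ) δ).indicator fun _ : ℝ => B ^ 2) MeasureTheory.volume :=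
    (MeasureTheory.integrable_indicator_iff measurableSet_Icc).2
      (MeasureTheory.integrableOn_const (by simp))
  have hle : ∫ y in (-1 : ℝ)..1, e y ^ 2
      ≤ ∫ y in (-1 : ℝ)..1, (A ^ 2 + (Set.Icc (-δ) δ).indicator (fun _ => B ^ 2) y) := by
    refine intervalIntegral.integral_mono_on (by norm_num) hI
      (intervalIntegrable_const.add hind.intervalIntegrable) fun y hy => ?_
    rcases h y hy with h1 | ⟨h1, h2⟩
    · have : 0 ≤ (Set.Icc (-δ) δ).indicator (fun _ : ℝ => B ^ 2) y :=
        Set.indicator_nonneg (fun _ _ => sq_nonneg B) y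
      have := sq_le_sq' (abs_le.1 h1).1 (abs_le.1 h1).2
      linarith
    · rw [Set.indicator_of_mem (Set.mem_Icc.2 (abs_le.1 h1))]
      have := sq_le_sq' (abs_le.1 h2).1 (abs_le.1 h2).2
      linarith [sq_nonneg A]
  refine hle.trans ?_
  rw [intervalIntegral.integral_add intervalIntegrable_const hind.intervalIntegrable,
    intervalIntegral.integral_const]
  have h2 : ∫ y in (-1 : ℝ)..1, (Set.Icc (-δ) δ).indicator (fun _ => B ^ 2) y
      ≤ 2 * δ * B ^ 2 := by
    rw [intervalIntegral.integral_of_le (by norm_num)]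
    calc _ ≤ ∫ y, (Set.Icc (-δ) δ).indicator (fun _ => B ^ 2) y :=
          MeasureTheory.setIntegral_le_integral hind
            (Filter.Eventually.of_forall (Set.indicator_nonneg fun _ _ => sq_nonneg B))
      _ = 2 * δ * B ^ 2 := by
          rw [MeasureTheory.integral_indicator measurableSet_Icc, MeasureTheory.setIntegral_const,
            Real.volume_real_Icc_of_le (by linarith), smul_eq_mul]
          ring
  have h3 : ((1 : ℝ) - -1) • A ^ 2 = 2 * A ^ 2 := by rw [smul_eq_mul]; norm_num
  linarith

theorem l2_interpolation_error (k : ℕ) (hk : 1 ≤ k) (lam α Cu : ℝ)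
    (hlam0 : 0 < lam) (hlam1 : lam < k + 1) (hCu : 0 < Cu)
    (hα0 : 0 < α) (hα : α ≤ min (lam / (k+1)) (1 / (2*(k+1))))
    (xhat : ℕ → ℝ) (hxhat0 : xhat 0 = 0) (hxhatk : xhat k = 1)
    (hxhatmono : ∀ j : ℕ, j < k → xhat j < xhat (j+1)) :
    ∃ C : ℝ, 0 < C ∧
      ∀ ε : ℝ, 0 < ε → ε ≤ 1 → ∀ N : ℕ, 1 ≤ N →
      ∀ u uI : ℝ → ℝ,
        ContDiffOn ℝ (k+1 : ℕ) u (Set.Icc (-1) 1) →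
        (∀ i : ℕ, i ≤ k+1 → ∀ y ∈ Set.Icc (-1:ℝ) 1,
          |iteratedDerivWithin i u (Set.Icc (-1) 1) y|
            ≤ Cu * (1 + (ε ^ ((1:ℝ)/2) + |y|) ^ (lam - i))) →
        IsLagrangeInterpolant (liseikinX α ε N) N k xhat u uI →
        Real.sqrt (∫ y in (-1:ℝ)..1, (u y - uI y)^2) ≤ C / (N:ℝ) ^ (k+1) := by
  have hk1 : (0 : ℝ) < k + 1 := by positivity
  have hαlam : α * (k + 1) ≤ lam := (le_div_iff₀ hk1).1 (hα.trans (min_le_left _ _))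
  have hα2 : α * (2 * (k + 1)) ≤ 1 :=
    (le_div_iff₀ (by positivity)).1 (hα.trans (min_le_right _ _))
  have hα1 : α ≤ 1 := by
    refine le_trans ?_ hα2
    have : (0 : ℝ) ≤ k := k.cast_nonneg
    nlinarith
  have hlt : ∀ i j : ℕ, i < j → j ≤ k → xhat i < xhat j := by
    intro i j hij
    induction j, hij using Nat.le_induction with
    | base => exact fun h => hxhatmono i h
    | succ j _ ih => exact fun h => (ih (by omega)).trans (hxhatmono j h)
  have hinj : Set.InjOn xhat (Finset.range (k + 1) : Set ℕ) := by
    intro i hi j hj hij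
    simp only [Finset.coe_range, Set.mem_Iio] at hi hj
    rcases lt_trichotomy i j with h | h | h
    · exact absurd hij (hlt i j h (by omega)).ne
    · exact h
    · exact absurd hij (hlt j i h (by omega)).ne'
  have hv : ∀ j ≤ k, xhat j ∈ Set.Icc (0 : ℝ) 1 := by
    intro j hj
    constructor
    · rcases Nat.eq_zero_or_pos j with rfl | h
      · exact hxhat0.ge
      · exact hxhat0 ▸ (hlt 0 j h hj).le
    · rcases hj.eq_or_lt with rfl | h
      · exact hxhatk.le
      · exact hxhatk ▸ (hlt j k h le_rfl).le
  obtain ⟨L, hL0, hL⟩ := exists_lebesgue_constant k xhat hinj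
  set A : ℝ := (1 + L) * (Cu * ((1 / α * 2 ^ (1 / α - 1)) ^ (k + 1) *
    (2 ^ ((1 - α) * (k + 1)) + 2 ^ (lam - α * (k + 1))))) with hA
  set B : ℝ := (1 + L) * (Cu * (1 + 2 ^ lam)) with hB
  have hA0 : 0 < A := by positivity
  refine ⟨Real.sqrt (2 * A ^ 2 + 2 * 2 ^ (1 / α) * B ^ 2), by positivity, ?_⟩
  intro ε hε hε1 N hN u uI hu hbd ⟨hcont, hinterp⟩
  have hN0 : (0 : ℝ) < N := by exact_mod_cast hN
  have hdich : ∀ y ∈ Set.Icc (-1 : ℝ) 1, |u y - uI y| ≤ A / (N : ℝ) ^ (k + 1) ∨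
      (|y| ≤ (2 / N) ^ (1 / α) ∧ |u y - uI y| ≤ B) := by
    intro y hy
    obtain ⟨i, hi1, hi2, a, b, z, rfl, rfl, hab, hsub, hyab, hz, hzw, hZ2, hZ⟩ :=
      exists_liseikin_element hα0 hα1 hε hε1 (N := N) (by omega) hy
    obtain ⟨⟨p, hp, hpeq⟩, hnode⟩ := hinterp i hi1 hi2
    rw [hpeq y hyab]
    refine abs_sub_le_on_element hv hL0 hL hα0 hα1 hlam0 hlam1 hαlam hCu.le hN0
      (Real.rpow_nonneg hε.le _) hab hsub hz hzw hZ2 hZ hu hbd hp (fun j hj => ?_) hyab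
    rw [← hnode j hj, hpeq]
    have := hv j hj
    exact ⟨by nlinarith [this.1], by nlinarith [this.2]⟩
  have hI := integral_sq_le_of_dichotomy (hu.continuousOn.sub hcont)
    (by positivity : (0 : ℝ) ≤ (2 / N) ^ (1 / α)) hdich
  have hδ : (2 / (N : ℝ)) ^ (1 / α) ≤ 2 ^ (1 / α) / ((N : ℝ) ^ (k + 1)) ^ 2 := by
    rw [Real.div_rpow (by norm_num) hN0.le, ← pow_mul, ← Real.rpow_natCast (N : ℝ)]
    gcongr
    · exact_mod_cast hN
    · rw [le_div_iff₀ hα0]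
      push_cast
      linarith
  rw [Real.sqrt_le_left (by positivity), div_pow, Real.sq_sqrt (by positivity)]
  calc ∫ y in (-1:ℝ)..1, (u y - uI y)^2
      ≤ 2 * (A / (N : ℝ) ^ (k + 1)) ^ 2 + 2 * (2 / (N : ℝ)) ^ (1 / α) * B ^ 2 := hI
    _ ≤ 2 * (A / (N : ℝ) ^ (k + 1)) ^ 2
          + 2 * (2 ^ (1 / α) / ((N : ℝ) ^ (k + 1)) ^ 2) * B ^ 2 := by gcongr
    _ = (2 * A ^ 2 + 2 * 2 ^ (1 / α) * B ^ 2) / ((N : ℝ) ^ (k + 1)) ^ 2 := by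
        field_simp
end

section
/- Let k ≥ 1 be an integer, λ ∈ (0, k+1), 0 < ε ≤ 1, and let u ∈ C^{k+1}([−1,1]) satisfy |u^{(i)}(x)| ≤ C_u (1 + (ε^{1/2} + |x|)^{λ−i}) for all 0 ≤ i ≤ k+1 and x ∈ [−1,1]. Let u_I be the degree-k piecewise Lagrange interpolant of u on the Liseikin mesh with parameter α satisfying 0 < α ≤ min{λ/(k+1), 1/(2(k+1))}. Then there is a constant C, depending only on α, λ, k, C_u and the interpolation nodes, but not on ε or N, such that the energy norm interpolation error satisfies |||u − u_I|||_ε := ( ε∫_{−1}^{1} ((u − u_I)')² dx + ∫_{−1}^{1} (u − u_I)² dx )^{1/2} ≤ C N^{−k}. -/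
open Set

theorem liseikinPhi_of_nonneg {α ε ξ : ℝ} (hε : 0 < ε) (hξ : 0 ≤ ξ) :
    liseikinPhi α ε ξ = ((ε ^ ((1 : ℝ) / 2)) ^ α + ξ * ((1 + ε ^ ((1 : ℝ) / 2)) ^ α
      - (ε ^ ((1 : ℝ) / 2)) ^ α)) ^ (1 / α) - ε ^ ((1 : ℝ) / 2) := by
  rw [liseikinPhi, if_pos hξ, ← Real.rpow_mul hε.le, one_div_mul_eq_div]

theorem liseikinPhi_neg {α ε ξ : ℝ} (hα : 0 < α) (hε : 0 < ε) (hξ : 0 ≤ ξ) :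
    liseikinPhi α ε (-ξ) = -liseikinPhi α ε ξ := by
  rcases hξ.eq_or_lt with rfl | h
  · have : liseikinPhi α ε 0 = 0 := by
      rw [liseikinPhi_of_nonneg hε le_rfl, zero_mul, add_zero, ← Real.rpow_mul (by positivity),
        mul_one_div_cancel hα.ne', Real.rpow_one, sub_self]
    simp [this]
  · rw [liseikinPhi, if_neg (by linarith), liseikinPhi, if_pos hξ, neg_neg, neg_sub]

theorem liseikinPhi_one {α ε : ℝ} (hα : 0 < α) (hε : 0 < ε) : liseikinPhi α ε 1 = 1 := by
  rw [liseikinPhi_of_nonneg hε zero_le_one, one_mul, add_sub_cancel,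
    ← Real.rpow_mul (by positivity), mul_one_div_cancel hα.ne', Real.rpow_one, add_sub_cancel_right]

theorem sub_le_of_rpow_le_rpow_add {α ℓ m d : ℝ} (hα : 0 < α) (hα1 : α ≤ 1) (hℓ : 0 < ℓ)
    (hm : 0 < m) (h : m ^ α ≤ ℓ ^ α + d) : m - ℓ ≤ 1 / α * d * m ^ (1 - α) := by
  have hmα : 0 < m ^ α := Real.rpow_pos_of_pos hm _
  have hb := one_add_mul_self_le_rpow_one_add (s := (ℓ / m) ^ α - 1)
    (by linarith [Real.rpow_nonneg (div_nonneg hℓ.le hm.le) α]) (p := 1 / α)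
    ((one_le_div hα).2 hα1)
  rw [add_sub_cancel, ← Real.rpow_mul (by positivity), mul_one_div_cancel hα.ne', Real.rpow_one,
    Real.div_rpow hℓ.le hm.le] at hb
  have h1 : 1 - d / m ^ α ≤ ℓ ^ α / m ^ α := by
    rw [le_div_iff₀ hmα, sub_mul, div_mul_cancel₀ _ hmα.ne']; linarith
  have h2 : 1 - 1 / α * (d / m ^ α) ≤ ℓ / m := by
    have : 1 / α * (-(d / m ^ α)) ≤ 1 / α * (ℓ ^ α / m ^ α - 1) :=
      mul_le_mul_of_nonneg_left (by linarith) (by positivity)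
    linarith
  have h3 := mul_le_mul_of_nonneg_right h2 hm.le
  rw [div_mul_cancel₀ _ hm.ne'] at h3
  rw [Real.rpow_sub hm, Real.rpow_one]
  have : 1 / α * d * (m / m ^ α) = 1 / α * (d / m ^ α) * m := by ring
  rw [this]; linarith

theorem exists_liseikin_radii {α ε : ℝ} {N n : ℕ} (hα : 0 < α) (hα1 : α ≤ 1) (hε : 0 < ε)
    (hn : n < N) :
    ∃ ℓ m : ℝ, ε ^ ((1 : ℝ) / 2) ≤ ℓ ∧ ℓ < m ∧ m ≤ 1 + ε ^ ((1 : ℝ) / 2) ∧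
      m ^ α ≤ ℓ ^ α + 1 / N ∧ liseikinPhi α ε (n / N) = ℓ - ε ^ ((1 : ℝ) / 2) ∧
      liseikinPhi α ε ((n + 1) / N) = m - ε ^ ((1 : ℝ) / 2) := by
  have hs : 0 < ε ^ ((1 : ℝ) / 2) := by positivity
  rw [liseikinPhi_of_nonneg hε (by positivity), liseikinPhi_of_nonneg hε (by positivity)]
  generalize ε ^ ((1 : ℝ) / 2) = s at hs ⊢
  have hN : (0 : ℝ) < N := by exact_mod_cast (Nat.zero_le n).trans_lt hn
  set D := (1 + s) ^ α - s ^ α with hD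
  have hD0 : 0 < D := sub_pos.2 (Real.rpow_lt_rpow hs.le (by linarith) hα)
  have hD1 : D ≤ 1 := by
    have := Real.rpow_add_le_add_rpow zero_le_one hs.le hα.le hα1
    rw [Real.one_rpow] at this
    linarith
  have hsα : 0 < s ^ α := by positivity
  have hα' : 0 < 1 / α := by positivity
  have hinv : ∀ t : ℝ, 0 ≤ t → (t ^ α) ^ (1 / α) = t := fun t ht => by
    rw [← Real.rpow_mul ht, mul_one_div_cancel hα.ne', Real.rpow_one]
  have hinv' : ∀ t : ℝ, 0 ≤ t → (t ^ (1 / α)) ^ α = t := fun t ht => by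
    rw [← Real.rpow_mul ht, one_div_mul_cancel hα.ne', Real.rpow_one]
  have hn1 : ((n : ℝ) + 1) / N ≤ 1 := by
    rw [div_le_one hN]; exact_mod_cast hn
  refine ⟨_, _, ?_, ?_, ?_, ?_, rfl, rfl⟩
  · conv_lhs => rw [← hinv s hs.le]
    refine Real.rpow_le_rpow hsα.le ?_ hα'.le
    have : 0 ≤ (n : ℝ) / N * D := by positivity
    linarith
  · refine Real.rpow_lt_rpow (by positivity) ?_ hα'
    gcongr
    linarith
  · conv_rhs => rw [← hinv (1 + s) (by positivity)]
    refine Real.rpow_le_rpow (by positivity) ?_ hα'.le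
    have := mul_le_mul_of_nonneg_right hn1 hD0.le
    linarith
  · rw [hinv' _ (by positivity), hinv' _ (by positivity)]
    have : D / N ≤ 1 / N := by gcongr
    have h2 : ((n : ℝ) + 1) / N * D = n / N * D + D / N := by ring
    linarith

/-- On each mesh interval, the distance to the origin shifted by `ε ^ (1 / 2)` ranges over an
interval `[ℓ, m]`. -/
theorem exists_liseikin_cell {α ε : ℝ} {N : ℕ} (hα : 0 < α) (hα1 : α ≤ 1) (hε : 0 < ε)
    {i : ℤ} (hi : -(N : ℤ) < i) (hiN : i ≤ N) :
    ∃ ℓ m : ℝ, ε ^ ((1 : ℝ) / 2) ≤ ℓ ∧ ℓ < m ∧ m ≤ 1 + ε ^ ((1 : ℝ) / 2) ∧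
      m ^ α ≤ ℓ ^ α + 1 / N ∧
      (liseikinX α ε N (i - 1) = ℓ - ε ^ ((1 : ℝ) / 2) ∧
        liseikinX α ε N i = m - ε ^ ((1 : ℝ) / 2) ∨
      liseikinX α ε N (i - 1) = ε ^ ((1 : ℝ) / 2) - m ∧
        liseikinX α ε N i = ε ^ ((1 : ℝ) / 2) - ℓ) := by
  rcases le_or_gt 1 i with h | h
  · obtain ⟨n, hn⟩ := Int.eq_ofNat_of_zero_le (sub_nonneg.2 h)
    obtain rfl : i = n + 1 := by omega
    obtain ⟨ℓ, m, h1, h2, h3, h4, h5, h6⟩ := exists_liseikin_radii hα hα1 hε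
      (show n < N by omega)
    refine ⟨ℓ, m, h1, h2, h3, h4, Or.inl ⟨?_, ?_⟩⟩
    · rw [← h5, liseikinX]; norm_num
    · rw [← h6, liseikinX]; norm_num
  · obtain ⟨n, hn⟩ := Int.eq_ofNat_of_zero_le (show 0 ≤ -i by omega)
    obtain rfl : i = -n := by omega
    obtain ⟨ℓ, m, h1, h2, h3, h4, h5, h6⟩ := exists_liseikin_radii hα hα1 hε
      (show n < N by omega)
    refine ⟨ℓ, m, h1, h2, h3, h4, Or.inr ⟨?_, ?_⟩⟩
    · rw [liseikinX, ← neg_sub m, ← h6, ← liseikinPhi_neg hα hε (by positivity)]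
      congr 1; push_cast; ring
    · rw [liseikinX, ← neg_sub ℓ, ← h5, ← liseikinPhi_neg hα hε (by positivity)]
      congr 1; push_cast; ring

theorem exists_mem_Ioo_of_notMem_range (x : ℤ → ℝ) (N : ℕ) {y : ℝ} (hy : y ∉ range x)
    (h1 : x (-N) ≤ y) (h2 : y ≤ x N) :
    ∃ i : ℤ, -(N : ℤ) < i ∧ i ≤ N ∧ y ∈ Ioo (x (i - 1)) (x i) := by
  have hne : ∀ i, y ≠ x i := fun i h => hy ⟨i, h.symm⟩
  by_contra! hcon
  have key : ∀ n : ℕ, n ≤ 2 * N → x (-N + n) < y := by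
    intro n
    induction n with
    | zero => intro _; simpa using lt_of_le_of_ne h1 (hne _).symm
    | succ n ih =>
      intro hn
      by_contra! hle
      refine hcon (-N + n + 1) (by omega) (by omega) ⟨?_, ?_⟩
      · simpa using ih (by omega)
      · refine lt_of_le_of_ne ?_ (hne _)
        simpa [add_assoc] using hle
  have := key (2 * N) le_rfl
  have he : -(N : ℤ) + (2 * N : ℕ) = N := by push_cast; ring
  rw [he] at this
  linarith

theorem cell_quantity_le {k : ℕ} {lam α Cu : ℝ} (hlam1 : lam < k + 1) (hCu : 0 < Cu)
    (hα0 : 0 < α) (hαlam : α * (k + 1) ≤ lam) {ℓ m n : ℝ} (hn : 0 < n) (hℓ : 0 < ℓ) (hlm : ℓ < m)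
    (hm : m ≤ 2) (hgood : m ≤ 2 ^ (1 / α) * ℓ) (hh : m - ℓ ≤ 1 / α * (1 / n) * m ^ (1 - α)) :
    m * (Cu * (1 + ℓ ^ (lam - (k + 1 : ℕ))) * (m - ℓ) ^ k) ≤
      Cu * (2 ^ (k + 1 - lam) + (2 ^ (1 / α)) ^ (k + 1 - lam)) * (1 / α) ^ k *
        2 ^ (lam - α * k) / n ^ k := by
  have hm0 : 0 < m := hℓ.trans hlm
  push_cast
  have hle : ∀ c t : ℝ, 0 < c → 0 < t → m ≤ c * t →
      t ^ (lam - (k + 1)) ≤ c ^ (k + 1 - lam) * m ^ (lam - (k + 1)) := by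
    intro c t hc ht hmt
    have := Real.rpow_le_rpow_of_nonpos hm0 hmt (show lam - (k + 1) ≤ 0 by linarith)
    rw [Real.mul_rpow hc.le ht.le] at this
    have h2 := mul_le_mul_of_nonneg_left this (Real.rpow_nonneg hc.le (k + 1 - lam))
    rw [← mul_assoc, ← Real.rpow_add hc] at h2
    simpa using h2
  have hM : 1 + ℓ ^ (lam - (k + 1)) ≤
      (2 ^ (k + 1 - lam) + (2 ^ (1 / α)) ^ (k + 1 - lam)) * m ^ (lam - (k + 1)) := by
    have e1 := hle 2 1 two_pos one_pos (by linarith)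
    have e2 := hle (2 ^ (1 / α)) ℓ (by positivity) hℓ hgood
    rw [Real.one_rpow] at e1
    linarith
  have hpow : (m - ℓ) ^ k ≤ (1 / α) ^ k / n ^ k * m ^ ((1 - α) * k) := by
    refine (pow_le_pow_left₀ (by linarith) hh k).trans_eq ?_
    rw [mul_pow, mul_pow, Real.rpow_mul hm0.le, Real.rpow_natCast, one_div n, inv_pow]
    ring
  have hexp : m * (m ^ (lam - (k + 1)) * m ^ ((1 - α) * k)) ≤ 2 ^ (lam - α * k) := by
    rw [← Real.rpow_add hm0]
    nth_rewrite 1 [← Real.rpow_one m]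
    rw [← Real.rpow_add hm0]
    have : 1 + (lam - (k + 1) + (1 - α) * k) = lam - α * k := by ring
    rw [this]
    exact Real.rpow_le_rpow hm0.le hm (by linarith)
  calc m * (Cu * (1 + ℓ ^ (lam - (k + 1))) * (m - ℓ) ^ k)
      ≤ m * (Cu * ((2 ^ (k + 1 - lam) + (2 ^ (1 / α)) ^ (k + 1 - lam)) * m ^ (lam - (k + 1))) *
        ((1 / α) ^ k / n ^ k * m ^ ((1 - α) * k))) := by
        have : 0 ≤ m - ℓ := by linarith
        gcongr
    _ = Cu * (2 ^ (k + 1 - lam) + (2 ^ (1 / α)) ^ (k + 1 - lam)) * (1 / α) ^ k / n ^ k *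
        (m * (m ^ (lam - (k + 1)) * m ^ ((1 - α) * k))) := by ring
    _ ≤ Cu * (2 ^ (k + 1 - lam) + (2 ^ (1 / α)) ^ (k + 1 - lam)) * (1 / α) ^ k / n ^ k *
        2 ^ (lam - α * k) := by gcongr
    _ = _ := by ring
theorem abs_le_of_zero_of_deriv_le {a b B : ℝ} {f f' : ℝ → ℝ} {z : ℝ}
    (hf : ∀ y ∈ Icc a b, HasDerivWithinAt f (f' y) (Icc a b) y)
    (hB : ∀ y ∈ Icc a b, |f' y| ≤ B) (hz : z ∈ Icc a b) (h0 : f z = 0) :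
    ∀ y ∈ Icc a b, |f y| ≤ B * (b - a) := by
  intro y hy
  have h := (convex_Icc a b).norm_image_sub_le_of_norm_hasDerivWithin_le hf
    (by simpa using hB) hz hy
  rw [h0, sub_zero, Real.norm_eq_abs, Real.norm_eq_abs] at h
  refine h.trans (mul_le_mul_of_nonneg_left ?_ ((abs_nonneg _).trans (hB y hy)))
  exact abs_sub_le_of_le_of_le hy.1 hy.2 hz.1 hz.2

theorem abs_iterated_deriv_le_of_zeros {a b M : ℝ} (k : ℕ) :
    ∀ (f : ℕ → ℝ → ℝ) (z : ℕ → ℝ),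
      (∀ j ≤ k, ∀ y ∈ Icc a b, HasDerivWithinAt (f j) (f (j + 1) y) (Icc a b) y) →
      (∀ j ≤ k, z j ∈ Icc a b) → (∀ j < k, z j < z (j + 1)) → (∀ j ≤ k, f 0 (z j) = 0) →
      (∀ y ∈ Icc a b, |f (k + 1) y| ≤ M) →
      ∀ j ≤ k + 1, ∀ y ∈ Icc a b, |f j y| ≤ M * (b - a) ^ (k + 1 - j) := by
  induction k with
  | zero =>
    intro f z hf hz _ h0 hM j hj y hy
    rcases Nat.le_one_iff_eq_zero_or_eq_one.1 hj with rfl | rfl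
    · simpa using abs_le_of_zero_of_deriv_le (hf 0 le_rfl) hM (hz 0 le_rfl) (h0 0 le_rfl) y hy
    · simpa using hM y hy
  | succ k ih =>
    intro f z hf hz hmono h0 hM
    have hrolle : ∀ j, ∃ w, j ≤ k → w ∈ Ioo (z j) (z (j + 1)) ∧ f 1 w = 0 := by
      intro j
      by_cases hj : j ≤ k
      · have hsub : Icc (z j) (z (j + 1)) ⊆ Icc a b :=
          Icc_subset_Icc (hz j (by omega)).1 (hz (j + 1) (by omega)).2
        obtain ⟨w, hw, hw0⟩ := exists_hasDerivAt_eq_zero (f := f 0) (f' := f 1)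
          (hmono j (by omega))
          (fun y hy => ((hf 0 (by omega) y (hsub hy)).mono hsub).continuousWithinAt)
          (by rw [h0 j (by omega), h0 (j + 1) (by omega)])
          (fun y hy => ((hf 0 (by omega) y (hsub (Ioo_subset_Icc_self hy))).mono hsub).hasDerivAt
            (Icc_mem_nhds hy.1 hy.2))
        exact ⟨w, fun _ => ⟨hw, hw0⟩⟩
      · exact ⟨0, fun h => absurd h hj⟩
    choose w hw using hrolle
    have key := ih (fun j => f (j + 1)) w (fun j hj => hf (j + 1) (by omega))
      (fun j hj => ⟨(hz j (by omega)).1.trans (hw j hj).1.1.le,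
        (hw j hj).1.2.le.trans (hz (j + 1) (by omega)).2⟩)
      (fun j hj => (hw j (by omega)).1.2.trans (hw (j + 1) (by omega)).1.1)
      (fun j hj => (hw j hj).2) hM
    intro j hj y hy
    rcases j with _ | j
    · have := abs_le_of_zero_of_deriv_le (hf 0 (by omega)) (key 0 (by omega)) (hz 0 (by omega))
        (h0 0 (by omega)) y hy
      simpa [pow_succ, mul_assoc] using this
    · simpa using key j (by omega) y hy

theorem exists_polynomial_bound_of_nodes (k : ℕ) (x : ℕ → ℝ)
    (hx : ∀ j < k, x j < x (j + 1)) :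
    ∃ K : ℝ, ∀ (q : Polynomial ℝ) (B : ℝ), q.natDegree ≤ k → (∀ j ≤ k, |q.eval (x j)| ≤ B) →
      ∀ t ∈ Icc (0 : ℝ) 1, |q.eval t| ≤ K * B ∧ |q.derivative.eval t| ≤ K * B := by
  have hinj : Set.InjOn x (Finset.range (k + 1) : Finset ℕ) := by
    have : StrictMonoOn x (Iic k) := by
      refine strictMonoOn_of_lt_add_one (ordConnected_Iic) ?_
      intro a _ _ h
      exact hx a (by simpa using h)
    refine this.injOn.mono ?_
    intro j hj
    simp at hj ⊢; omega
  have hbd : ∀ p : Polynomial ℝ, ∃ K : ℝ, ∀ t ∈ Icc (0 : ℝ) 1, |p.eval t| ≤ K := fun p =>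
    (isCompact_Icc.exists_bound_of_continuousOn p.continuous.continuousOn)
  choose K hK using hbd
  have hK0 : ∀ p, 0 ≤ K p := fun p => (abs_nonneg _).trans (hK p 0 (by simp))
  let L := fun j => Lagrange.basis (Finset.range (k + 1)) x j
  refine ⟨∑ j ∈ Finset.range (k + 1), (K (L j) + K (L j).derivative), ?_⟩
  intro q B hq hB t ht
  have hqe : q = ∑ j ∈ Finset.range (k + 1), Polynomial.C (q.eval (x j)) * L j := by
    have h := Lagrange.eq_interpolate (f := q) hinj (by
      rw [Finset.card_range]
      exact (Polynomial.degree_le_of_natDegree_le hq).trans_lt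
        (by exact_mod_cast Nat.lt_succ_self k))
    rw [Lagrange.interpolate_apply] at h
    exact h
  have hterm : ∀ c : ℝ, ∀ j ∈ Finset.range (k + 1), |c| ≤ K (L j) + K (L j).derivative →
      |q.eval (x j) * c| ≤ (K (L j) + K (L j).derivative) * B := by
    intro c j hj hc
    rw [abs_mul, mul_comm]
    exact mul_le_mul hc (hB j (by simpa [Nat.lt_succ_iff] using hj)) (abs_nonneg _)
      (add_nonneg (hK0 _) (hK0 _))
  constructor
  · conv_lhs => rw [hqe]
    rw [Polynomial.eval_finsetSum, Finset.sum_mul]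
    refine (Finset.abs_sum_le_sum_abs _ _).trans (Finset.sum_le_sum fun j hj => ?_)
    rw [Polynomial.eval_mul, Polynomial.eval_C]
    exact hterm _ j hj ((hK _ t ht).trans (le_add_of_nonneg_right (hK0 _)))
  · conv_lhs => rw [hqe]
    rw [Polynomial.derivative_sum, Polynomial.eval_finsetSum, Finset.sum_mul]
    refine (Finset.abs_sum_le_sum_abs _ _).trans (Finset.sum_le_sum fun j hj => ?_)
    rw [Polynomial.derivative_C_mul, Polynomial.eval_mul, Polynomial.eval_C]
    exact hterm _ j hj ((hK _ t ht).trans (le_add_of_nonneg_left (hK0 _)))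

section Interpolation

variable {S : Set ℝ} {u : ℝ → ℝ} {a b : ℝ} {p : Polynomial ℝ} {k : ℕ} {x : ℕ → ℝ}

theorem node_mem_Icc (hx0 : x 0 = 0) (hxk : x k = 1) (hx : ∀ j < k, x j < x (j + 1)) {j : ℕ}
    (hj : j ≤ k) : x j ∈ Icc (0 : ℝ) 1 := by
  have hmono : MonotoneOn x (Iic k) := by
    refine monotoneOn_of_le_add_one ordConnected_Iic ?_
    intro a _ _ h
    exact (hx a (by simpa using h)).le
  exact ⟨hx0 ▸ hmono (mem_Iic.2 (Nat.zero_le k)) hj (Nat.zero_le j),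
    hxk ▸ hmono (mem_Iic.2 hj) (mem_Iic.2 le_rfl) hj⟩

theorem add_sub_mul_mem_Icc (hab : a < b) {t : ℝ} (ht : t ∈ Icc (0 : ℝ) 1) :
    a + (b - a) * t ∈ Icc a b :=
  ⟨by nlinarith [ht.1, ht.2], by nlinarith [ht.1, ht.2]⟩

theorem abs_sub_lagrange_le (hS : UniqueDiffOn ℝ S) (hu : ContDiffOn ℝ (k + 1 : ℕ) u S)
    (hab : a < b) (hsub : Icc a b ⊆ S) (hp : p.natDegree ≤ k)
    (hx0 : x 0 = 0) (hxk : x k = 1) (hx : ∀ j < k, x j < x (j + 1))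
    (hpu : ∀ j ≤ k, p.eval (a + (b - a) * x j) = u (a + (b - a) * x j)) {M : ℝ}
    (hM : ∀ y ∈ Icc a b, |iteratedDerivWithin (k + 1) u S y| ≤ M) {y : ℝ} (hy : y ∈ Icc a b) :
    |u y - p.eval y| ≤ M * (b - a) ^ (k + 1) ∧
      |derivWithin u S y - p.derivative.eval y| ≤ M * (b - a) ^ k := by
  have key := abs_iterated_deriv_le_of_zeros (a := a) (b := b) (M := M) k
    (fun j y => iteratedDerivWithin j u S y - (Polynomial.derivative^[j] p).eval y)
    (fun j => a + (b - a) * x j) ?_ ?_ ?_ ?_ ?_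
  · constructor
    · simpa using key 0 (by omega) y hy
    · simpa [iteratedDerivWithin_one] using key 1 (by omega) y hy
  · intro j hj y hy
    have h1 := (hu.differentiableOn_iteratedDerivWithin (m := j)
      (by exact_mod_cast Nat.lt_succ_of_le hj) hS y (hsub hy)).hasDerivWithinAt
    rw [← iteratedDerivWithin_succ] at h1
    refine (h1.mono hsub).sub ?_
    rw [Function.iterate_succ_apply']
    exact ((Polynomial.derivative^[j] p).hasDerivAt y).hasDerivWithinAt
  · exact fun j hj => add_sub_mul_mem_Icc hab (node_mem_Icc hx0 hxk hx hj)
  · intro j hj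
    have := mul_lt_mul_of_pos_left (hx j hj) (sub_pos.2 hab)
    linarith
  · intro j hj
    simp [hpu j hj]
  · intro y hy
    simpa [Polynomial.iterate_derivative_eq_zero (Nat.lt_succ_of_le hp)] using hM y hy

theorem abs_sub_lagrange_le_of_bound {K : ℝ}
    (hK : ∀ (q : Polynomial ℝ) (B : ℝ), q.natDegree ≤ k → (∀ j ≤ k, |q.eval (x j)| ≤ B) →
      ∀ t ∈ Icc (0 : ℝ) 1, |q.eval t| ≤ K * B ∧ |q.derivative.eval t| ≤ K * B)
    (hu : DifferentiableOn ℝ u S) (hab : a < b) (hsub : Icc a b ⊆ S) (hp : p.natDegree ≤ k)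
    (hx0 : x 0 = 0) (hxk : x k = 1) (hx : ∀ j < k, x j < x (j + 1))
    (hpu : ∀ j ≤ k, p.eval (a + (b - a) * x j) = u (a + (b - a) * x j)) {B B' : ℝ}
    (hB : ∀ y ∈ Icc a b, |u y| ≤ B) (hB' : ∀ y ∈ Icc a b, |derivWithin u S y| ≤ B')
    {y : ℝ} (hy : y ∈ Icc a b) :
    |u y - p.eval y| ≤ (1 + K) * B ∧
      |derivWithin u S y - p.derivative.eval y| ≤ (1 + K) * B' := by
  have hh : 0 < b - a := sub_pos.2 hab
  have hnode : ∀ j ≤ k, a + (b - a) * x j ∈ Icc a b := fun j hj =>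
    add_sub_mul_mem_Icc hab (node_mem_Icc hx0 hxk hx hj)
  have ht : (y - a) / (b - a) ∈ Icc (0 : ℝ) 1 :=
    ⟨div_nonneg (by linarith [hy.1]) hh.le, (div_le_one hh).2 (by linarith [hy.2])⟩
  have hty : a + (b - a) * ((y - a) / (b - a)) = y := by
    rw [mul_div_cancel₀ _ hh.ne']; ring
  let ψ : Polynomial ℝ := Polynomial.C (b - a) * Polynomial.X + Polynomial.C a
  have hψ : ∀ t, ψ.eval t = a + (b - a) * t := fun t => by simp [ψ, add_comm]
  have hψ1 : ψ.natDegree ≤ 1 := Polynomial.natDegree_linear_le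
  have hcomp : (p.comp ψ).natDegree ≤ k :=
    Polynomial.natDegree_comp_le.trans ((Nat.mul_le_mul hp hψ1).trans_eq (mul_one k))
  have h1 := (hK (p.comp ψ) B hcomp (fun j hj => by
    rw [Polynomial.eval_comp, hψ, hpu j hj]; exact hB _ (hnode j hj)) _ ht).1
  have h2 := (hK (p.comp ψ - Polynomial.C (u a)) (B' * (b - a))
    (by rwa [Polynomial.natDegree_sub_C]) (fun j hj => by
      rw [Polynomial.eval_sub, Polynomial.eval_comp, hψ, hpu j hj, Polynomial.eval_C]
      have := (convex_Icc a b).norm_image_sub_le_of_norm_hasDerivWithin_le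
        (fun z hz => ((hu z (hsub hz)).hasDerivWithinAt).mono hsub) hB'
        (left_mem_Icc.2 hab.le) (hnode j hj)
      refine this.trans (mul_le_mul_of_nonneg_left ?_
        ((abs_nonneg _).trans (hB' a (left_mem_Icc.2 hab.le))))
      rw [Real.norm_eq_abs]
      exact abs_sub_le_of_le_of_le (hnode j hj).1 (hnode j hj).2 le_rfl hab.le) _ ht).2
  rw [Polynomial.eval_comp, hψ, hty] at h1
  have hψ' : Polynomial.derivative ψ = Polynomial.C (b - a) := by simp [ψ]
  rw [Polynomial.derivative_sub, Polynomial.derivative_C, sub_zero, Polynomial.derivative_comp,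
    hψ', Polynomial.eval_mul, Polynomial.eval_C, Polynomial.eval_comp, hψ, hty, abs_mul,
    abs_of_pos hh, mul_comm, ← mul_assoc] at h2
  have h3 := le_of_mul_le_mul_right h2 hh
  constructor
  · refine (abs_sub _ _).trans ?_
    linarith [hB y hy]
  · refine (abs_sub _ _).trans ?_
    linarith [hB' y hy]

theorem deriv_sub_eq_of_eqOn {v : ℝ → ℝ} (hu : DifferentiableOn ℝ u S) (hsub : Icc a b ⊆ S)
    (hv : ∀ y ∈ Icc a b, v y = p.eval y) {y : ℝ} (hy : y ∈ Ioo a b) :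
    deriv (fun z => u z - v z) y = derivWithin u S y - p.derivative.eval y := by
  have hnhds : Icc a b ∈ nhds y := Icc_mem_nhds hy.1 hy.2
  have h1 : HasDerivAt u (derivWithin u S y) y :=
    (hu y (hsub (Ioo_subset_Icc_self hy))).hasDerivWithinAt.hasDerivAt
      (Filter.mem_of_superset hnhds hsub)
  have h2 : HasDerivAt v (p.derivative.eval y) y :=
    (p.hasDerivAt y).congr_of_eventuallyEq (Filter.eventually_of_mem hnhds hv)
  exact (h1.sub h2).deriv

end Interpolation

theorem integral_sq_le_of_abs_le {g : ℝ → ℝ} {T : Set ℝ} (hT : T.Countable) {K L δ : ℝ}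
    (hδ : 0 ≤ δ) (hK : ∀ y ∈ Icc (-1 : ℝ) 1, y ∉ T → |g y| ≤ K)
    (hL : ∀ y ∈ Icc (-1 : ℝ) 1, y ∉ T → |y| ≤ δ ∨ |g y| ≤ L) :
    ∫ y in (-1 : ℝ)..1, g y ^ 2 ≤ 2 * L ^ 2 + 2 * δ * K ^ 2 := by
  rw [intervalIntegral.integral_of_le (by norm_num)]
  have hind : MeasureTheory.Integrable ((Icc (-δ) δ).indicator fun _ => K ^ 2)
      (MeasureTheory.volume.restrict (Ioc (-1 : ℝ) 1)) :=
    (MeasureTheory.integrable_const _).indicator measurableSet_Icc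
  have hmono := MeasureTheory.integral_mono_of_nonneg
    (μ := MeasureTheory.volume.restrict (Ioc (-1 : ℝ) 1)) (f := fun y => g y ^ 2)
    (g := fun y => L ^ 2 + (Icc (-δ) δ).indicator (fun _ => K ^ 2) y)
    (Filter.Eventually.of_forall fun y => sq_nonneg (g y))
    ((MeasureTheory.integrable_const _).add hind) (by
      filter_upwards [MeasureTheory.ae_restrict_mem measurableSet_Ioc,
        MeasureTheory.ae_restrict_of_ae (hT.ae_notMem MeasureTheory.volume)] with y hy hyT
      have hy' := Ioc_subset_Icc_self hy
      by_cases hyδ : y ∈ Icc (-δ) δ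
      · rw [indicator_of_mem hyδ]
        have : g y ^ 2 ≤ K ^ 2 := sq_le_sq.2 ((hK y hy' hyT).trans (le_abs_self K))
        linarith [sq_nonneg L]
      · rw [indicator_of_notMem hyδ, add_zero]
        exact sq_le_sq.2 (((hL y hy' hyT).resolve_left fun h => hyδ (abs_le.1 h)).trans
          (le_abs_self L)))
  refine hmono.trans ?_
  rw [MeasureTheory.integral_add (MeasureTheory.integrable_const _) hind,
    MeasureTheory.integral_indicator measurableSet_Icc, MeasureTheory.integral_const,
    MeasureTheory.integral_const, smul_eq_mul, smul_eq_mul,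
    MeasureTheory.Measure.restrict_restrict measurableSet_Icc]
  have h1 : (MeasureTheory.volume.restrict (Ioc (-1 : ℝ) 1)).real univ = 2 := by
    rw [MeasureTheory.measureReal_restrict_apply_univ, Real.volume_real_Ioc_of_le (by norm_num)]
    norm_num
  have h2 : (MeasureTheory.volume.restrict (Icc (-δ) δ ∩ Ioc (-1 : ℝ) 1)).real univ ≤ 2 * δ := by
    rw [MeasureTheory.measureReal_restrict_apply_univ]
    refine (MeasureTheory.measureReal_mono inter_subset_left
      (by simp)).trans_eq ?_
    rw [Real.volume_real_Icc_of_le (by linarith)]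
    ring
  rw [h1]
  gcongr

theorem abs_le_of_rpow_le {α y : ℝ} {k N : ℕ} (hα : 0 < α) (hαk : α * (2 * k) ≤ 1) (hN : 1 ≤ N)
    (h : |y| ^ α ≤ 2 / N) : |y| ≤ 2 ^ (1 / α) / (N : ℝ) ^ (2 * k) := by
  have hN' : (1 : ℝ) ≤ N := by exact_mod_cast hN
  have h1 := Real.rpow_le_rpow (by positivity) h (show 0 ≤ 1 / α by positivity)
  rw [← Real.rpow_mul (abs_nonneg y), mul_one_div_cancel hα.ne', Real.rpow_one,
    Real.div_rpow two_pos.le (by positivity)] at h1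
  refine h1.trans ?_
  gcongr
  rw [← Real.rpow_natCast]
  refine Real.rpow_le_rpow_of_exponent_le hN' ?_
  rw [le_div_iff₀ hα]
  push_cast
  linarith

theorem mul_one_add_rpow_sub_one_le {s t lam : ℝ} (hlam : 0 ≤ lam) (hs : 0 < s) (hs1 : s ≤ 1)
    (hst : s ≤ t) (ht : t ≤ 2) : s * (1 + t ^ (lam - 1)) ≤ 1 + 2 ^ lam := by
  have ht0 : 0 < t := hs.trans_le hst
  have h1 : s * t ^ (lam - 1) ≤ t * t ^ (lam - 1) := by gcongr
  have h2 : t * t ^ (lam - 1) = t ^ lam := by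
    rw [Real.rpow_sub_one ht0.ne', mul_div_cancel₀ _ ht0.ne']
  have h3 : t ^ lam ≤ 2 ^ lam := Real.rpow_le_rpow ht0.le ht hlam
  linarith

theorem exists_pointwise_error_bound {k : ℕ} {lam α Cu : ℝ}
    (hlam0 : 0 < lam) (hlam1 : lam < k + 1) (hCu : 0 < Cu) (hα0 : 0 < α) (hα1 : α ≤ 1)
    (hαlam : α * (k + 1) ≤ lam) (hαk : α * (2 * k) ≤ 1)
    {xhat : ℕ → ℝ} (hxhat0 : xhat 0 = 0) (hxhatk : xhat k = 1)
    (hxhatmono : ∀ j : ℕ, j < k → xhat j < xhat (j + 1)) :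
    ∃ K L : ℝ, ∀ ε : ℝ, 0 < ε → ε ≤ 1 → ∀ N : ℕ, 1 ≤ N → ∀ u uI : ℝ → ℝ,
      ContDiffOn ℝ (k + 1 : ℕ) u (Icc (-1) 1) →
      (∀ i : ℕ, i ≤ k + 1 → ∀ y ∈ Icc (-1 : ℝ) 1,
        |iteratedDerivWithin i u (Icc (-1) 1) y|
          ≤ Cu * (1 + (ε ^ ((1 : ℝ) / 2) + |y|) ^ (lam - i))) →
      IsLagrangeInterpolant (liseikinX α ε N) N k xhat u uI →
      ∀ y ∈ Icc (-1 : ℝ) 1, y ∉ range (liseikinX α ε N) →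
        (|u y - uI y| ≤ K ∧
          |ε ^ ((1 : ℝ) / 2) * deriv (fun z => u z - uI z) y| ≤ K) ∧
        (|y| ≤ 2 ^ (1 / α) / (N : ℝ) ^ (2 * k) ∨
          |u y - uI y| ≤ L / (N : ℝ) ^ k ∧
            |ε ^ ((1 : ℝ) / 2) * deriv (fun z => u z - uI z) y| ≤ L / (N : ℝ) ^ k) := by
  obtain ⟨K, hK⟩ := exists_polynomial_bound_of_nodes k xhat hxhatmono
  refine ⟨(1 + K) * (Cu * (1 + 2 ^ lam)),
    Cu * (2 ^ (k + 1 - lam) + (2 ^ (1 / α)) ^ (k + 1 - lam)) * (1 / α) ^ k * 2 ^ (lam - α * k), ?_⟩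
  intro ε hε hε1 N hN u uI hu hder hI y hy hyX
  have hN0 : (0 : ℝ) < N := by exact_mod_cast hN
  have hXN : liseikinX α ε N N = 1 := by
    rw [liseikinX, Int.cast_natCast, div_self hN0.ne', liseikinPhi_one hα0 hε]
  have hXN' : liseikinX α ε N (-N) = -1 := by
    rw [liseikinX, Int.cast_neg, Int.cast_natCast, neg_div, div_self hN0.ne',
      liseikinPhi_neg hα0 hε zero_le_one, liseikinPhi_one hα0 hε]
  obtain ⟨i, hi, hiN, hyi⟩ := exists_mem_Ioo_of_notMem_range _ N hyX (hXN' ▸ hy.1) (hXN ▸ hy.2)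
  obtain ⟨⟨p, hp, hpI⟩, hnode⟩ := hI.2 i hi hiN
  obtain ⟨ℓ, m, hsℓ, hℓm, hm, hmα, hcell⟩ := exists_liseikin_cell hα0 hα1 hε hi hiN
  have hs0 : 0 < ε ^ ((1 : ℝ) / 2) := by positivity
  have hs1 : ε ^ ((1 : ℝ) / 2) ≤ 1 := Real.rpow_le_one hε.le hε1 (by norm_num)
  generalize ε ^ ((1 : ℝ) / 2) = s at *
  generalize liseikinX α ε N (i - 1) = a at *
  generalize liseikinX α ε N i = b at *
  have hℓ0 : 0 < ℓ := hs0.trans_le hsℓ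
  have hm0 : 0 < m := hℓ0.trans hℓm
  have hba : b - a = m - ℓ := by rcases hcell with ⟨rfl, rfl⟩ | ⟨rfl, rfl⟩ <;> ring
  have hab : a < b := by linarith
  have hsub : Icc a b ⊆ Icc (-1 : ℝ) 1 := by
    rcases hcell with ⟨rfl, rfl⟩ | ⟨rfl, rfl⟩ <;> exact Icc_subset_Icc (by linarith) (by linarith)
  have habs : ∀ z ∈ Icc a b, ℓ ≤ s + |z| ∧ s + |z| ≤ m := by
    rintro z ⟨hz1, hz2⟩
    rcases hcell with ⟨rfl, rfl⟩ | ⟨rfl, rfl⟩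
    · rw [abs_of_nonneg (by linarith)]
      constructor <;> linarith
    · rw [abs_of_nonpos (by linarith)]
      constructor <;> linarith
  have hyc : y ∈ Icc a b := Ioo_subset_Icc_self hyi
  have hS : UniqueDiffOn ℝ (Icc (-1 : ℝ) 1) := uniqueDiffOn_Icc (by norm_num)
  have hdiff : DifferentiableOn ℝ u (Icc (-1) 1) :=
    hu.differentiableOn (by exact_mod_cast Nat.succ_ne_zero k)
  have hpu : ∀ j ≤ k, p.eval (a + (b - a) * xhat j) = u (a + (b - a) * xhat j) := fun j hj => by
    rw [← hnode j hj, hpI _ (add_sub_mul_mem_Icc hab (node_mem_Icc hxhat0 hxhatk hxhatmono hj))]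
  rw [deriv_sub_eq_of_eqOn hdiff hsub hpI hyi, hpI y hyc, abs_mul, abs_of_pos hs0]
  constructor
  · have hstab := abs_sub_lagrange_le_of_bound hK hdiff hab hsub hp hxhat0 hxhatk hxhatmono hpu
      (B := Cu * (1 + 2 ^ lam)) (B' := Cu * (1 + 2 ^ lam) / s) (fun z hz => by
        have h := hder 0 (Nat.zero_le _) z (hsub hz)
        rw [iteratedDerivWithin_zero, Nat.cast_zero, sub_zero] at h
        refine h.trans ?_
        have := habs z hz
        gcongr
        linarith) (fun z hz => by
        have h := hder 1 (by omega) z (hsub hz)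
        rw [iteratedDerivWithin_one, Nat.cast_one] at h
        rw [le_div_iff₀ hs0]
        have h2 := mul_one_add_rpow_sub_one_le hlam0.le hs0 hs1 (hsℓ.trans (habs z hz).1)
          (show s + |z| ≤ 2 by linarith [(habs z hz).2])
        calc _ ≤ Cu * (1 + (s + |z|) ^ (lam - 1)) * s := by gcongr
          _ = Cu * (s * (1 + (s + |z|) ^ (lam - 1))) := by ring
          _ ≤ _ := by gcongr) hyc
    refine ⟨hstab.1, (mul_le_mul_of_nonneg_left hstab.2 hs0.le).trans_eq ?_⟩
    field_simp
  · by_cases hsmall : ℓ ^ α < 1 / N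
    · left
      refine abs_le_of_rpow_le hα0 hαk hN ?_
      have h1 : |y| ^ α ≤ m ^ α :=
        Real.rpow_le_rpow (abs_nonneg y) (by linarith [(habs y hyc).2]) hα0.le
      have h2 : (2 : ℝ) / N = 1 / N + 1 / N := by ring
      linarith
    · right
      have hgood : m ≤ 2 ^ (1 / α) * ℓ := by
        have h1 : m ^ α ≤ 2 * ℓ ^ α := by linarith
        have h2 := Real.rpow_le_rpow (by positivity) h1 (show 0 ≤ 1 / α by positivity)
        rwa [Real.mul_rpow two_pos.le (by positivity), ← Real.rpow_mul hm0.le,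
          ← Real.rpow_mul hℓ0.le, mul_one_div_cancel hα0.ne', Real.rpow_one, Real.rpow_one] at h2
      have hq := cell_quantity_le hlam1 hCu hα0 hαlam hN0 hℓ0 hℓm (by linarith) hgood
        (sub_le_of_rpow_le_rpow_add hα0 hα1 hℓ0 hm0 hmα)
      have herr := abs_sub_lagrange_le hS hu hab hsub hp hxhat0 hxhatk hxhatmono hpu
        (M := Cu * (1 + ℓ ^ (lam - (k + 1 : ℕ)))) (fun z hz => by
          refine (hder (k + 1) le_rfl z (hsub hz)).trans ?_
          have := Real.rpow_le_rpow_of_nonpos hℓ0 (habs z hz).1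
            (show lam - (k + 1 : ℕ) ≤ 0 by push_cast; linarith)
          gcongr) hyc
      rw [hba] at herr
      have hnonneg : 0 ≤ Cu * (1 + ℓ ^ (lam - (k + 1 : ℕ))) * (m - ℓ) ^ k := by
        have : 0 < m - ℓ := by linarith
        positivity
      constructor
      · refine herr.1.trans (le_trans ?_ hq)
        rw [pow_succ, ← mul_assoc, mul_comm]
        exact mul_le_mul_of_nonneg_right (by linarith) hnonneg
      · refine le_trans ?_ hq
        exact mul_le_mul (by linarith) herr.2 (abs_nonneg _) hm0.le

theorem energy_interpolation_error (k : ℕ) (hk : 1 ≤ k) (lam α Cu : ℝ)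
    (hlam0 : 0 < lam) (hlam1 : lam < k + 1) (hCu : 0 < Cu)
    (hα0 : 0 < α) (hα : α ≤ min (lam / (k+1)) (1 / (2*(k+1))))
    (xhat : ℕ → ℝ) (hxhat0 : xhat 0 = 0) (hxhatk : xhat k = 1)
    (hxhatmono : ∀ j : ℕ, j < k → xhat j < xhat (j+1)) :
    ∃ C : ℝ, 0 < C ∧
      ∀ ε : ℝ, 0 < ε → ε ≤ 1 → ∀ N : ℕ, 1 ≤ N →
      ∀ u uI : ℝ → ℝ,
        ContDiffOn ℝ (k+1 : ℕ) u (Set.Icc (-1) 1) →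
        (∀ i : ℕ, i ≤ k+1 → ∀ y ∈ Set.Icc (-1:ℝ) 1,
          |iteratedDerivWithin i u (Set.Icc (-1) 1) y|
            ≤ Cu * (1 + (ε ^ ((1:ℝ)/2) + |y|) ^ (lam - i))) →
        IsLagrangeInterpolant (liseikinX α ε N) N k xhat u uI →
        Real.sqrt (ε * (∫ y in (-1:ℝ)..1, (deriv (fun z => u z - uI z) y)^2)
            + ∫ y in (-1:ℝ)..1, (u y - uI y)^2)
          ≤ C / (N:ℝ) ^ k := by
  have hk1 : (0 : ℝ) < k + 1 := by positivity
  have hα2 := (le_div_iff₀ (by positivity)).1 (hα.trans (min_le_right _ _))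
  have hαlam := (le_div_iff₀ hk1).1 (hα.trans (min_le_left _ _))
  have hkα : 0 ≤ α * k := by positivity
  obtain ⟨K, L, hKL⟩ := exists_pointwise_error_bound hlam0 hlam1 hCu hα0 (by linarith) hαlam
    (by linarith) hxhat0 hxhatk hxhatmono
  set Q := 4 * L ^ 2 + 4 * 2 ^ (1 / α) * K ^ 2 with hQ
  have hQ0 : 0 ≤ Q := by positivity
  refine ⟨Q + 1, by linarith, ?_⟩
  intro ε hε hε1 N hN u uI hu hder hI
  have hN0 : (0 : ℝ) < N := by exact_mod_cast hN
  have hpt := hKL ε hε hε1 N hN u uI hu hder hI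
  have hT : (range (liseikinX α ε N)).Countable := countable_range _
  have hδ : 0 ≤ 2 ^ (1 / α) / (N : ℝ) ^ (2 * k) := by positivity
  have h1 := integral_sq_le_of_abs_le (g := fun y => u y - uI y) hT hδ
    (fun y hy hyT => (hpt y hy hyT).1.1) (fun y hy hyT => (hpt y hy hyT).2.imp_right And.left)
  have h2 := integral_sq_le_of_abs_le
    (g := fun y => ε ^ ((1 : ℝ) / 2) * deriv (fun z => u z - uI z) y) hT hδ
    (fun y hy hyT => (hpt y hy hyT).1.2) (fun y hy hyT => (hpt y hy hyT).2.imp_right And.right)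
  have hsq : (ε ^ ((1 : ℝ) / 2)) ^ 2 = ε := by
    rw [← Real.sqrt_eq_rpow, Real.sq_sqrt hε.le]
  simp only [mul_pow, hsq, intervalIntegral.integral_const_mul] at h2
  refine Real.sqrt_le_iff.2 ⟨by positivity, (add_le_add h2 h1).trans ?_⟩
  rw [div_pow, div_pow, ← pow_mul, mul_comm k 2]
  calc _ = Q / (N : ℝ) ^ (2 * k) := by rw [hQ]; ring
    _ ≤ (Q + 1) ^ 2 / (N : ℝ) ^ (2 * k) := by gcongr; nlinarith
end
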